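/- The degree d(f) of the gradient map grad(f) depends only on the reduced polynomial f_red associated to f; that is, if f and g are non-constant homogeneous polynomials in ℂ[x₀,…,x_n] with the same reduced polynomial (equivalently, with the same zero set in ℙⁿ), then d(f) = d(g). -/

import Mathlib

open MvPolynomial CategoryTheory
open scoped BigOperators unitInterval

noncomputable section

/-! ### Projective space, hypersurfaces and the degree of the gradient map -/

/-- `ℙⁿ(ℂ)`, realized as the projectivization of `ℂ^{n+1}`. -/
abbrev Proj (n : ℕ) := Projectivization ℂ (Fin (n + 1) → ℂ)

instance (n : ℕ) : TopologicalSpace (Proj n) :=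
  inferInstanceAs (TopologicalSpace (Quotient _))

variable {n : ℕ}

/-- The projective zero set `V(f)` of a homogeneous polynomial `f`. -/
def projZeros (f : MvPolynomial (Fin (n + 1)) ℂ) : Set (Proj n) :=
  {x | eval x.rep f = 0}

/-- The principal open set `D(f) = {x ∈ ℙⁿ : f(x) ≠ 0}`. -/
def principalOpen (f : MvPolynomial (Fin (n + 1)) ℂ) : Set (Proj n) :=
  {x | eval x.rep f ≠ 0}

/-- The gradient vector `(f₀(x), …, f_n(x))` of `f` at (a representative of) `x`. -/
def gradVec (f : MvPolynomial (Fin (n + 1)) ℂ) (x : Proj n) : Fin (n + 1) → ℂ :=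
  fun i => eval x.rep (pderiv i f)

/-- The singular locus of the projective hypersurface `V(f)`. -/
def singularLocus (f : MvPolynomial (Fin (n + 1)) ℂ) : Set (Proj n) :=
  {x | eval x.rep f = 0 ∧ ∀ i, eval x.rep (pderiv i f) = 0}

/-- Zariski-closed subsets of `ℙⁿ`: common zero sets of families of homogeneous
polynomials. -/
def IsZariskiClosed (S : Set (Proj n)) : Prop :=
  ∃ T : Set (MvPolynomial (Fin (n + 1)) ℂ),
    (∀ g ∈ T, ∃ m, g.IsHomogeneous m) ∧ S = {x | ∀ g ∈ T, eval x.rep g = 0}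

/-- `U` is a Zariski open and dense subset of `ℙⁿ` (dense: it meets every nonempty
Zariski open set). -/
def IsZariskiOpenDense (U : Set (Proj n)) : Prop :=
  IsZariskiClosed Uᶜ ∧
    ∀ W : Set (Proj n), IsZariskiClosed Wᶜ → W.Nonempty → (U ∩ W).Nonempty

/-- The fiber over `u` of the gradient map `φ_f = grad f : D(f) → ℙⁿ`. -/
def gradFiber (f : MvPolynomial (Fin (n + 1)) ℂ) (u : Proj n) : Set (Proj n) :=
  {x | x ∈ principalOpen f ∧
       ∃ h : gradVec f x ≠ 0, Projectivization.mk ℂ (gradVec f x) h = u}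

/-- `d(f) = k`: there is a Zariski open and dense subset `U ⊆ ℙⁿ` over which every
fiber of the gradient map has exactly `k` points.  (If the gradient map is not
dominant this holds precisely for `k = 0`, taking for `U` the complement of the
closure of the image, so this single definition covers both cases.) -/
def HasGradDegree (f : MvPolynomial (Fin (n + 1)) ℂ) (k : ℕ) : Prop :=
  ∃ U : Set (Proj n), IsZariskiOpenDense U ∧
    ∀ u ∈ U, (gradFiber f u).Finite ∧ (gradFiber f u).ncard = k

/-- The hyperplane of `ℙⁿ` with coefficient vector `c`. -/
def hyperplane (c : Fin (n + 1) → ℂ) : Set (Proj n) :=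
  {x | ∑ i, c i * x.rep i = 0}

section LogDerivation

open IsDedekindDomain WithZero

/-- Every element of `C` satisfies, modulo the prime `v`, a monic equation over `O` of which it is
a simple root. -/
lemma exists_simple_root_mod {O C : Type*} [CommRing O] [CommRing C] [Algebra O C]
    [Algebra.IsIntegral O C] (hO : ∀ m : ℕ, m ≠ 0 → IsUnit (m : O))
    (v : HeightOneSpectrum C) (b : C) :
    ∃ p : Polynomial O, Polynomial.aeval b p ∈ v.asIdeal ∧
      Polynomial.aeval b (Polynomial.derivative p) ∉ v.asIdeal := by
  classical
  have hex : ∃ m : ℕ, ∃ p : Polynomial O, p.Monic ∧ p.natDegree = m ∧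
      Polynomial.aeval b p ∈ v.asIdeal := by
    obtain ⟨p, hp, hpb⟩ := Algebra.IsIntegral.isIntegral (R := O) b
    exact ⟨_, p, hp, rfl, by
      rw [Polynomial.aeval_def, hpb]; exact v.asIdeal.zero_mem⟩
  obtain ⟨p, hp, hdeg, hpb⟩ := Nat.find_spec hex
  refine ⟨p, hpb, fun hder => ?_⟩
  set m := Nat.find hex with hm
  have hone : (1 : C) ∉ v.asIdeal := (Ideal.ne_top_iff_one _).1 v.isPrime.ne_top
  have hm0 : m ≠ 0 := by
    intro h0
    rw [h0] at hdeg
    rw [hp.natDegree_eq_zero.1 hdeg] at hpb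
    exact hone (by simpa using hpb)
  obtain ⟨c, hc⟩ := (hO m hm0).exists_left_inv
  have : Nontrivial O := ⟨0, 1, fun h => hone <| by
    have := congrArg (algebraMap O C) h
    rw [map_zero, map_one] at this
    exact this ▸ v.asIdeal.zero_mem⟩
  have hcoef : (Polynomial.C c * Polynomial.derivative p).coeff (m - 1) = 1 := by
    rw [Polynomial.coeff_C_mul, Polynomial.coeff_derivative]
    have h1 : m - 1 + 1 = m := by omega
    have h2 : ((m - 1 : ℕ) : O) + 1 = m := by rw [← Nat.cast_succ, Nat.succ_eq_add_one, h1]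
    rw [h1, h2, ← hdeg, Polynomial.Monic.coeff_natDegree hp, one_mul, hdeg, hc]
  have hle : (Polynomial.C c * Polynomial.derivative p).natDegree ≤ m - 1 :=
    (Polynomial.natDegree_C_mul_le _ _).trans
      ((Polynomial.natDegree_derivative_le p).trans (by omega))
  have hmonic := Polynomial.monic_of_natDegree_le_of_coeff_eq_one _ hle hcoef
  refine Nat.find_min hex (m := (Polynomial.C c * Polynomial.derivative p).natDegree) (by omega)
    ⟨_, hmonic, rfl, ?_⟩
  rw [map_mul]
  exact v.asIdeal.mul_mem_left _ hder

lemma valuation_natCast_eq_one {O C L : Type*} [CommRing O] [CommRing C] [IsDedekindDomain C]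
    [Field L] [Algebra C L] [IsFractionRing C L] [Algebra O C]
    (hO : ∀ m : ℕ, m ≠ 0 → IsUnit (m : O)) (v : HeightOneSpectrum C)
    {m : ℕ} (hm : m ≠ 0) : v.valuation L (m : L) = 1 := by
  have : IsUnit (m : C) := by simpa using (hO m hm).map (algebraMap O C)
  rw [← map_natCast (algebraMap C L), v.valuation_eq_one_iff_notMem]
  exact fun h => v.isPrime.ne_top (Ideal.eq_top_of_isUnit_mem _ h this)

variable {k O C L : Type*} [CommRing k] [CommRing O] [CommRing C] [IsDedekindDomain C] [Field L]
  [Algebra C L] [IsFractionRing C L] [Algebra O C] [Algebra O L] [IsScalarTower O C L] [Algebra k L]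

/-- A derivation that does not decrease the order at `v` and is topologically nilpotent on `O`
is topologically nilpotent on all `v`-integers. -/
lemma valuation_derivation_lt_one [Algebra.IsIntegral O C] (hO : ∀ m : ℕ, m ≠ 0 → IsUnit (m : O))
    (v : HeightOneSpectrum C) (D : Derivation k L L)
    (hD : ∀ y, v.valuation L (D y) ≤ v.valuation L y)
    (hDO : ∀ o : O, v.valuation L (D (algebraMap O L o)) < 1)
    {y : L} (hy : v.valuation L y ≤ 1) : v.valuation L (D y) < 1 := by
  have hOle : ∀ o : O, v.valuation L (algebraMap O L o) ≤ 1 := fun o => by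
    rw [IsScalarTower.algebraMap_apply O C L]; exact v.valuation_le_one _
  have hC : ∀ b : C, v.valuation L (D (algebraMap C L b)) < 1 := by
    intro b
    obtain ⟨p, hp, hp'⟩ := exists_simple_root_mod hO v b
    have key : ∀ q : Polynomial O, v.valuation L (D (Polynomial.aeval (algebraMap C L b) q) -
        Polynomial.aeval (algebraMap C L b) (Polynomial.derivative q) *
          D (algebraMap C L b)) < 1 := by
      intro q
      induction q using Polynomial.induction_on' with
      | add p q hp hq =>
        have := Valuation.map_add_lt _ hp hq
        convert this using 2
        simp only [map_add]
        ring
      | monomial m a =>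
        have : D (Polynomial.aeval (algebraMap C L b) (Polynomial.monomial m a)) -
            Polynomial.aeval (algebraMap C L b) (Polynomial.derivative (Polynomial.monomial m a)) *
              D (algebraMap C L b) = (algebraMap C L b) ^ m * D (algebraMap O L a) := by
          rw [Polynomial.derivative_monomial, Polynomial.aeval_monomial, Polynomial.aeval_monomial,
            Derivation.leibniz, Derivation.leibniz_pow]
          simp only [smul_eq_mul, nsmul_eq_mul, map_mul, map_natCast]
          ring
        rw [this, map_mul, map_pow]
        exact mul_lt_one_of_nonneg_of_lt_one_right (pow_le_one' (v.valuation_le_one b) m)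
          zero_le (hDO a)
    have h1 := key p
    rw [Polynomial.aeval_algebraMap_apply, Polynomial.aeval_algebraMap_apply] at h1
    have h2 : v.valuation L (D (algebraMap C L (Polynomial.aeval b p))) < 1 :=
      (hD _).trans_lt ((v.valuation_lt_one_iff_mem _).2 hp)
    have h3 := Valuation.map_sub_lt _ h2 h1
    rw [sub_sub_cancel, map_mul, (v.valuation_eq_one_iff_notMem).2 hp', one_mul] at h3
    exact h3
  obtain ⟨a, ⟨b, hb⟩, hab⟩ := v.exists_primeCompl_mul_eq_of_integer y hy
  have hb1 : v.valuation L (algebraMap C L b) = 1 := (v.valuation_eq_one_iff_notMem).2 hb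
  have h := hC a
  rw [← hab, Derivation.leibniz, smul_eq_mul, smul_eq_mul] at h
  have h2 : v.valuation L (y * D (algebraMap C L b)) < 1 := by
    rw [map_mul]
    exact mul_lt_one_of_nonneg_of_lt_one_right hy zero_le (hC b)
  have h3 := Valuation.map_sub_lt _ h h2
  rwa [add_sub_cancel_left, map_mul, hb1, one_mul] at h3

/-- The units whose logarithmic derivative has valuation at most `c`. -/
def logDerivBounded {Γ : Type*} [LinearOrderedCommGroupWithZero Γ] (w : Valuation L Γ)
    (D : Derivation k L L) (c : Γ) : Subgroup Lˣ where
  carrier := {y | w (D y / y) ≤ c}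
  one_mem' := by simp
  mul_mem' {x y} hx hy := by
    have : D (x * y : L) / (x * y) = D x / x + D y / y := by
      have := x.ne_zero
      have := y.ne_zero
      rw [Derivation.leibniz, smul_eq_mul, smul_eq_mul]
      field_simp
      ring
    simp only [Set.mem_ofPred_eq, Units.val_mul, this] at *
    exact Valuation.map_add_le _ hx hy
  inv_mem' {x} hx := by
    have : D (x : L)⁻¹ / (x : L)⁻¹ = -(D x / x) := by
      have := x.ne_zero
      rw [Derivation.leibniz_inv, smul_eq_mul]
      field_simp
    simp only [Set.mem_ofPred_eq] at *
    rwa [Units.val_inv_eq_inv_val, this, Valuation.map_neg]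

lemma mem_logDerivBounded {Γ : Type*} [LinearOrderedCommGroupWithZero Γ] {w : Valuation L Γ}
    {D : Derivation k L L} {c : Γ} {y : Lˣ} :
    y ∈ logDerivBounded w D c ↔ w (D y / y) ≤ c := Iff.rfl

lemma pow_mem_logDerivBounded {Γ : Type*} [LinearOrderedCommGroupWithZero Γ] {w : Valuation L Γ}
    {D : Derivation k L L} {c : Γ} {y : Lˣ} {m : ℕ} (hm : w m = 1)
    (h : y ^ m ∈ logDerivBounded w D c) : y ∈ logDerivBounded w D c := by
  rw [mem_logDerivBounded] at *
  have hy := y.ne_zero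
  have : D ((y : L) ^ m) / (y : L) ^ m = m * (D y / y) := by
    rcases m with _ | m
    · simp
    · rw [Derivation.leibniz_pow, smul_eq_mul, nsmul_eq_mul, Nat.add_sub_cancel]
      field_simp
      ring
  rwa [Units.val_pow_eq_pow_val, this, map_mul, hm, one_mul] at h

lemma lt_one_iff_le_exp_neg_one (x : ℤᵐ⁰) : x < 1 ↔ x ≤ exp (-1) := by
  rw [← lt_mul_exp_iff_le exp_ne_zero, ← exp_add]
  simp

/-- If `v` is a place at which `π` has positive order, then any subgroup of `Lˣ` containing `π` and
the `v`-units contains some positive power, prime to `v`, of every element. -/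
lemma exists_pow_mem_of_units_mem (v : HeightOneSpectrum C) (S : Subgroup Lˣ) (π : Lˣ)
    (hπ : v.valuation L (π : L) < 1) (hπS : π ∈ S)
    (hS : ∀ y : Lˣ, v.valuation L (y : L) = 1 → y ∈ S) (y : Lˣ) :
    ∃ m : ℕ, m ≠ 0 ∧ y ^ m ∈ S := by
  obtain ⟨e, he⟩ : ∃ e : ℤ, v.valuation L (π : L) = exp e :=
    ⟨_, (exp_log ((Valuation.ne_zero_iff _).2 π.ne_zero)).symm⟩
  obtain ⟨j, hj⟩ : ∃ j : ℤ, v.valuation L (y : L) = exp j :=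
    ⟨_, (exp_log ((Valuation.ne_zero_iff _).2 y.ne_zero)).symm⟩
  have he0 : e < 0 := by rwa [he, ← exp_zero, exp_lt_exp] at hπ
  refine ⟨e.natAbs, by omega, ?_⟩
  have hmem : y ^ e.natAbs * π ^ j ∈ S := by
    apply hS
    rw [Units.val_mul, Units.val_pow_eq_pow_val, Units.val_zpow_eq_zpow_val, map_mul, map_pow,
      map_zpow₀, he, hj, ← exp_nsmul, ← exp_zsmul, ← exp_add, exp_eq_one]
    simp only [nsmul_eq_mul, zsmul_eq_mul, Int.cast_id]
    rw [Int.natCast_natAbs, abs_of_neg he0]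
    ring
  exact (S.mul_mem_cancel_right (S.zpow_mem hπS j)).1 hmem

/-- A derivation of `L` that preserves `O` has bounded logarithmic derivatives at each place. -/
lemma exists_logDeriv_bound [Module.Finite O C] (v : HeightOneSpectrum C) (D : Derivation k L L)
    (hDO : ∀ o : O, v.valuation L (D (algebraMap O L o)) ≤ 1) :
    ∃ N : ℕ, ∀ y : Lˣ, v.valuation L (D y / y) ≤ exp (N : ℤ) := by
  have hOle : ∀ o : O, v.valuation L (algebraMap O L o) ≤ 1 := fun o => by
    rw [IsScalarTower.algebraMap_apply O C L]; exact v.valuation_le_one _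
  obtain ⟨ϖ, hϖ⟩ := v.valuation_exists_uniformizer L
  have hϖ0 : ϖ ≠ 0 := (Valuation.ne_zero_iff _).1 (hϖ ▸ exp_ne_zero)
  obtain ⟨s, hs⟩ := (Module.Finite.fg_top : (⊤ : Submodule O C).FG)
  have hub : ∀ z : ℤᵐ⁰, ∃ N : ℕ, z ≤ exp (N : ℤ) := by
    intro z
    rcases eq_or_ne z 0 with rfl | hz
    · exact ⟨0, zero_le⟩
    · exact ⟨(log z).toNat, by
        rw [← exp_log hz, exp_le_exp, log_exp]; exact Int.self_le_toNat _⟩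
  choose B hB using hub
  obtain ⟨N, hN⟩ := (insert (B (v.valuation L (D ϖ / ϖ)))
    (s.image fun c => B (v.valuation L (D (algebraMap C L c))))).exists_le
  have hϖN : v.valuation L (D ϖ / ϖ) ≤ exp (N : ℤ) :=
    (hB _).trans (exp_le_exp.2 (by exact_mod_cast hN _ (Finset.mem_insert_self _ _)))
  have h1N : (1 : ℤᵐ⁰) ≤ exp (N : ℤ) := by
    rw [← exp_zero, exp_le_exp]; positivity
  have hC : ∀ c : C, v.valuation L (D (algebraMap C L c)) ≤ exp (N : ℤ) := by
    intro c
    have hc : c ∈ Submodule.span O (s : Set C) := hs ▸ Submodule.mem_top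
    induction hc using Submodule.span_induction with
    | mem c hc =>
      exact (hB _).trans (exp_le_exp.2 (by
        exact_mod_cast hN _ (Finset.mem_insert_of_mem (Finset.mem_image_of_mem _ hc))))
    | zero => simp
    | add x y _ _ hx hy =>
      rw [map_add, map_add]
      exact Valuation.map_add_le _ hx hy
    | smul o x _ hx =>
      rw [Algebra.smul_def, map_mul, ← IsScalarTower.algebraMap_apply, Derivation.leibniz,
        smul_eq_mul, smul_eq_mul]
      refine Valuation.map_add_le _ ?_ ?_
      · rw [map_mul]
        exact (mul_le_mul' (hOle o) hx).trans (one_mul _).le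
      · rw [map_mul]
        exact (mul_le_mul' (v.valuation_le_one x) (hDO o)).trans ((one_mul _).le.trans h1N)
  have hunit : ∀ y : Lˣ, v.valuation L (y : L) = 1 →
      y ∈ logDerivBounded (v.valuation L) D (exp (N : ℤ)) := by
    intro y hy
    obtain ⟨a, ⟨b, hb⟩, hab⟩ := v.exists_primeCompl_mul_eq_of_integer (y : L) hy.le
    have hb1 : v.valuation L (algebraMap C L b) = 1 := (v.valuation_eq_one_iff_notMem).2 hb
    have hb0 : algebraMap C L b ≠ 0 := (Valuation.ne_zero_iff _).1 (by rw [hb1]; exact one_ne_zero)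
    have ha1 : v.valuation L (algebraMap C L a) = 1 := by rw [← hab, map_mul, hy, hb1, one_mul]
    have ha0 : algebraMap C L a ≠ 0 := (Valuation.ne_zero_iff _).1 (by rw [ha1]; exact one_ne_zero)
    have hyeq : y = Units.mk0 _ ha0 * (Units.mk0 _ hb0)⁻¹ := by
      rw [eq_mul_inv_iff_mul_eq]; ext; exact hab
    rw [hyeq]
    refine mul_mem ?_ (inv_mem ?_)
    · rw [mem_logDerivBounded, Units.val_mk0, map_div₀, ha1, div_one]; exact hC a
    · rw [mem_logDerivBounded, Units.val_mk0, map_div₀, hb1, div_one]; exact hC b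
  refine ⟨N, fun y => ?_⟩
  rw [← mem_logDerivBounded]
  obtain ⟨j, hj⟩ : ∃ j : ℤ, v.valuation L (y : L) = exp j :=
    ⟨_, (exp_log ((Valuation.ne_zero_iff _).2 y.ne_zero)).symm⟩
  refine (Subgroup.mul_mem_cancel_right _
    (Subgroup.zpow_mem _ (x := Units.mk0 ϖ hϖ0) hϖN j)).1 (hunit _ ?_)
  rw [Units.val_mul, Units.val_zpow_eq_zpow_val, Units.val_mk0, map_mul, map_zpow₀, hϖ, hj,
    ← exp_zsmul, ← exp_add, exp_eq_one]
  simp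

/-- A derivation which preserves `O` and the ideal generated by `π` does not decrease the order at
any place `v` above `π`. -/
lemma valuation_logDeriv_le_one [Module.Finite O C] (hO : ∀ m : ℕ, m ≠ 0 → IsUnit (m : O))
    (v : HeightOneSpectrum C) (D : Derivation k L L)
    (hDO : ∀ o : O, v.valuation L (D (algebraMap O L o)) ≤ 1)
    (π : Lˣ) (hπ : v.valuation L (π : L) < 1) (hDπ : v.valuation L (D π / π) ≤ 1) (y : Lˣ) :
    v.valuation L (D y / y) ≤ 1 := by
  classical
  have hex := exists_logDeriv_bound v D hDO
  suffices h : Nat.find hex = 0 by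
    have := Nat.find_spec hex y
    rwa [h, Nat.cast_zero, exp_zero] at this
  by_contra hN
  obtain ⟨N, hN⟩ := Nat.exists_eq_succ_of_ne_zero hN
  refine Nat.find_min hex (m := N) (by omega) fun y => ?_
  have hspec := Nat.find_spec hex
  rw [hN] at hspec
  obtain ⟨ϖ, hϖ⟩ := v.valuation_surjective L (exp (-(N + 1 : ℕ) : ℤ))
  have hlt : v.valuation L ϖ < 1 := by
    rw [hϖ, ← exp_zero, exp_lt_exp]; omega
  set δ : Derivation k L L := ϖ • D with hδ
  have hδle : ∀ y : Lˣ, v.valuation L (δ y / y) ≤ 1 := by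
    intro y
    rw [hδ, Derivation.smul_apply, smul_eq_mul, mul_div_assoc, map_mul, hϖ]
    refine (mul_le_mul_right (hspec y) _).trans ?_
    rw [← exp_add]; simp
  have hδO : ∀ o : O, v.valuation L (δ (algebraMap O L o)) < 1 := by
    intro o
    rw [hδ, Derivation.smul_apply, smul_eq_mul, map_mul]
    exact mul_lt_one_of_lt_of_le hlt (hDO o)
  have hδle' : ∀ y, v.valuation L (δ y) ≤ v.valuation L y := by
    intro y
    rcases eq_or_ne y 0 with rfl | hy
    · simp
    · have := hδle (Units.mk0 y hy)
      rw [Units.val_mk0, map_div₀] at this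
      exact (div_le_one₀ (zero_lt_iff.2 ((Valuation.ne_zero_iff _).2 hy))).1 this
  obtain ⟨m, hm, hmem⟩ := exists_pow_mem_of_units_mem v
    (logDerivBounded (v.valuation L) δ (exp (-1))) π hπ
    (by
      rw [mem_logDerivBounded, ← lt_one_iff_le_exp_neg_one, hδ, Derivation.smul_apply, smul_eq_mul,
        mul_div_assoc, map_mul]
      exact mul_lt_one_of_lt_of_le hlt hDπ)
    (fun y hy => by
      rw [mem_logDerivBounded, ← lt_one_iff_le_exp_neg_one, map_div₀, hy, div_one]
      exact valuation_derivation_lt_one hO v δ hδle' hδO hy.le) y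
  have := pow_mem_logDerivBounded (valuation_natCast_eq_one hO v hm) hmem
  rw [mem_logDerivBounded, hδ, Derivation.smul_apply, smul_eq_mul, mul_div_assoc, map_mul,
    hϖ] at this
  have h2 := mul_le_mul_right this (exp ((N + 1 : ℕ) : ℤ))
  rw [← mul_assoc, ← exp_add, ← exp_add] at h2
  simpa using h2

end LogDerivation

section DerivationExtension

/-- Derivations extend along formally étale algebras. -/
lemma Derivation.exists_extension {k S T : Type*} [CommRing k] [CommRing S] [CommRing T]
    [Algebra k S] [Algebra k T] [Algebra S T] [IsScalarTower k S T] [Algebra.FormallyEtale S T]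
    (d : Derivation k S T) :
    ∃ D : Derivation k T T, ∀ s, D (algebraMap S T s) = d s := by
  refine ⟨((d.liftKaehlerDifferential.liftBaseChange T) ∘ₗ
    (KaehlerDifferential.tensorKaehlerEquivOfFormallyEtale k S T).symm.toLinearMap).compDer
      (KaehlerDifferential.D k T), fun s => ?_⟩
  change (d.liftKaehlerDifferential.liftBaseChange T)
    ((KaehlerDifferential.tensorKaehlerEquivOfFormallyEtale k S T).symm
      (KaehlerDifferential.D k T (algebraMap S T s))) = d s
  simp only [KaehlerDifferential.tensorKaehlerEquivOfFormallyEtale_symm_D_algebraMap,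
    LinearMap.liftBaseChange_tmul, one_smul, Derivation.liftKaehlerDifferential_comp_D]

/-- Derivations of a domain of characteristic zero extend to algebraic extensions of its fraction
field. -/
lemma Derivation.exists_extension_of_isAlgebraic {k S K L : Type*} [CommRing k] [CommRing S]
    [Field K] [Field L] [CharZero K] [Algebra k S] [Algebra k L] [Algebra S L]
    [IsScalarTower k S L] [Algebra S K] [IsFractionRing S K] [Algebra K L] [IsScalarTower S K L]
    [Algebra.IsAlgebraic K L] (d : Derivation k S S) :
    ∃ D : Derivation k L L, ∀ s, D (algebraMap S L s) = algebraMap S L (d s) := by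
  have h1 : Algebra.FormallyEtale S K := .of_isLocalization (nonZeroDivisors S)
  have h2 : Algebra.FormallyEtale K L := .of_isSeparable K L
  have h3 : Algebra.FormallyEtale S L := .comp S K L
  obtain ⟨D, hD⟩ := Derivation.exists_extension ((Algebra.linearMap S L).compDer d)
  exact ⟨D, fun s => by rw [hD]; simp⟩

lemma Derivation.map_mvPolynomial_aeval {k τ L : Type*} [CommRing k] [Fintype τ] [CommRing L]
    [Algebra k L] (D : Derivation k L L) (x : τ → L) (p : MvPolynomial τ k) :
    D (aeval x p) = ∑ i, aeval x (pderiv i p) * D (x i) := by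
  classical
  induction p using MvPolynomial.induction_on with
  | C a => simp
  | add p q hp hq => simp only [map_add, hp, hq, add_mul, Finset.sum_add_distrib]
  | mul_X p i hp =>
    simp only [map_mul, aeval_X, Derivation.leibniz, hp, pderiv_X, smul_eq_mul, map_add, add_mul,
      Finset.sum_add_distrib, Finset.mul_sum, Pi.single_apply]
    congr 1
    · simp
    · exact Finset.sum_congr rfl fun j _ => by ring

end DerivationExtension

section Place

open IsDedekindDomain WithZero

variable {k O C L : Type*} [CommRing k] [CommRing O] [CommRing C] [IsDedekindDomain C] [Field L]
  [Algebra C L] [IsFractionRing C L] [Algebra O C] [Algebra O L] [IsScalarTower O C L] [Algebra k L]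

/-- An element whose logarithmic derivative along `π ∂/∂π` is topologically nilpotent is a unit. -/
lemma valuation_eq_one_of_euler_lt_one [Algebra.IsIntegral O C]
    (hO : ∀ m : ℕ, m ≠ 0 → IsUnit (m : O))
    (v : HeightOneSpectrum C) (D : Derivation k L L)
    (hD : ∀ y : Lˣ, v.valuation L (D y / y) ≤ 1)
    (hDO : ∀ o : O, v.valuation L (D (algebraMap O L o)) < 1)
    (π : Lˣ) (hDπ : D π = π) (y : Lˣ)
    (hy : v.valuation L (D y / y) < 1) : v.valuation L (y : L) = 1 := by
  have hD' : ∀ y, v.valuation L (D y) ≤ v.valuation L y := by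
    intro y
    rcases eq_or_ne y 0 with rfl | hy
    · simp
    · have := hD (Units.mk0 y hy)
      rw [Units.val_mk0, map_div₀] at this
      exact (div_le_one₀ (zero_lt_iff.2 ((Valuation.ne_zero_iff _).2 hy))).1 this
  obtain ⟨e, he⟩ : ∃ e : ℤ, v.valuation L (π : L) = exp e :=
    ⟨_, (exp_log ((Valuation.ne_zero_iff _).2 π.ne_zero)).symm⟩
  obtain ⟨j, hj⟩ : ∃ j : ℤ, v.valuation L (y : L) = exp j :=
    ⟨_, (exp_log ((Valuation.ne_zero_iff _).2 y.ne_zero)).symm⟩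
  rw [lt_one_iff_le_exp_neg_one] at hy
  have hmem : y ^ e * (π ^ j)⁻¹ ∈ logDerivBounded (v.valuation L) D (exp (-1)) := by
    have h1 : v.valuation L ((y ^ e * (π ^ j)⁻¹ : Lˣ) : L) = 1 := by
      rw [Units.val_mul, ← zpow_neg, Units.val_zpow_eq_zpow_val, Units.val_zpow_eq_zpow_val,
        map_mul, map_zpow₀, map_zpow₀, he, hj, ← exp_zsmul, ← exp_zsmul, ← exp_add, exp_eq_one]
      simp only [zsmul_eq_mul, Int.cast_id]
      ring
    rw [mem_logDerivBounded, ← lt_one_iff_le_exp_neg_one, map_div₀, h1, div_one]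
    exact valuation_derivation_lt_one hO v D hD' hDO h1.le
  have hπj : π ^ j ∈ logDerivBounded (v.valuation L) D (exp (-1)) := by
    rw [← inv_mem_iff]
    exact (Subgroup.mul_mem_cancel_left _ (Subgroup.zpow_mem _ hy e)).1 hmem
  have hj0 : j = 0 := by
    by_contra hj0
    have h2 : π ^ j.natAbs ∈ logDerivBounded (v.valuation L) D (exp (-1)) := by
      rcases Int.natAbs_eq j with h | h
      · rw [h, zpow_natCast] at hπj; exact hπj
      · rw [h, zpow_neg, zpow_natCast, inv_mem_iff] at hπj; exact hπj
    have h3 := pow_mem_logDerivBounded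
      (valuation_natCast_eq_one hO v (by omega : j.natAbs ≠ 0)) h2
    rw [mem_logDerivBounded, hDπ, div_self π.ne_zero, map_one, ← lt_one_iff_le_exp_neg_one] at h3
    exact lt_irrefl _ h3
  rw [hj, hj0, exp_zero]

end Place

section GradientFamily

open IsDedekindDomain WithZero

variable {τ : Type*} [Fintype τ] {O C L : Type*} [CommRing O] [CommRing C] [IsDedekindDomain C]
  [Field L] [Algebra C L] [IsFractionRing C L] [Algebra O C] [Algebra O L]
  [IsScalarTower O C L] [Algebra ℂ L] [Algebra (MvPolynomial (Option τ) ℂ) L]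
  [IsScalarTower ℂ (MvPolynomial (Option τ) ℂ) L] [Algebra (MvPolynomial (Option τ) ℂ) O]
  [IsScalarTower (MvPolynomial (Option τ) ℂ) O L]
  [Module.Finite O C]

/-- Along a place `v` of `L` above `t = 0`, the solutions `x` of
`(1 - t) ∇f(x)/f(x) + t ∇g(x)/g(x) = u` stay bounded, and `f(x)` stays away from zero. -/
lemma valuation_solution (K : Type*) [Field K] [Algebra (MvPolynomial (Option τ) ℂ) K]
    [IsFractionRing (MvPolynomial (Option τ) ℂ) K] [Algebra K L]
    [IsScalarTower (MvPolynomial (Option τ) ℂ) K L] [Algebra.IsAlgebraic K L]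
    [(Ideal.span {(X none : MvPolynomial (Option τ) ℂ)}).IsPrime]
    [IsLocalization.AtPrime O (Ideal.span {(X none : MvPolynomial (Option τ) ℂ)})]
    (v : HeightOneSpectrum C) {df dg : ℕ} {f g : MvPolynomial τ ℂ}
    (hf : f.IsHomogeneous df) (hg : g.IsHomogeneous dg) (x : τ → L)
    (hfx : aeval x f ≠ 0) (hgx : aeval x g ≠ 0)
    (hx : ∀ j, algebraMap (MvPolynomial (Option τ) ℂ) L (X (some j)) =
      (1 - algebraMap (MvPolynomial (Option τ) ℂ) L (X none)) *
          (aeval x (pderiv j f) / aeval x f) +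
        algebraMap (MvPolynomial (Option τ) ℂ) L (X none) * (aeval x (pderiv j g) / aeval x g)) :
    (∀ j, v.valuation L (x j) ≤ 1) ∧ v.valuation L (aeval x f) = 1 := by
  classical
  set R := MvPolynomial (Option τ) ℂ with hR
  set 𝔭 := Ideal.span {(X none : R)} with h𝔭
  set ι := algebraMap R L with hι
  set T := ι (X none) with hT
  have hιO : ∀ r, ι r = algebraMap O L (algebraMap R O r) := fun r =>
    IsScalarTower.algebraMap_apply R O L r
  have hιinj : Function.Injective ι := by
    rw [hι, IsScalarTower.algebraMap_eq R K L]
    exact (algebraMap K L).injective.comp (IsFractionRing.injective R K)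
  have hT0 : T ≠ 0 := by
    rw [hT, Ne, map_eq_zero_iff _ hιinj]; exact X_ne_zero _
  have : Algebra.IsIntegral O C := inferInstance
  have hlocal : IsLocalRing O := IsLocalization.AtPrime.isLocalRing O 𝔭
  have hO : ∀ m : ℕ, m ≠ 0 → IsUnit (m : O) := by
    intro m hm
    have : IsUnit ((m : ℂ)) := (Nat.cast_ne_zero.2 hm).isUnit
    simpa using (this.map (algebraMap ℂ R)).map (algebraMap R O)
  have hOle : ∀ o : O, v.valuation L (algebraMap O L o) ≤ 1 := fun o => by
    rw [IsScalarTower.algebraMap_apply O C L]; exact v.valuation_le_one _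
  have hRle : ∀ r : R, v.valuation L (ι r) ≤ 1 := fun r => by rw [hιO]; exact hOle _
  have hunit : ∀ r : R, r ∉ 𝔭 → v.valuation L (ι r) = 1 := by
    intro r hr
    have := (IsLocalization.map_units O (⟨r, hr⟩ : 𝔭.primeCompl)).map (algebraMap O C)
    rw [hιO, IsScalarTower.algebraMap_apply O C L, v.valuation_eq_one_iff_notMem]
    exact fun h => v.isPrime.ne_top (Ideal.eq_top_of_isUnit_mem _ h this)
  have hTlt : v.valuation L T < 1 := by
    rw [hT, hιO, IsScalarTower.algebraMap_apply O C L, v.valuation_lt_one_iff_mem]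
    have := v.isMaximal
    have hmax := Ideal.isMaximal_comap_of_isIntegral_of_isMaximal (R := O) v.asIdeal
    rw [← Ideal.mem_comap, IsLocalRing.eq_maximalIdeal hmax]
    exact (IsLocalization.AtPrime.to_map_mem_maximal_iff O 𝔭 _).2
      (Ideal.subset_span (Set.mem_singleton _))
  have hquot : ∀ (D : Derivation ℂ L L) (c : ℤᵐ⁰),
      (∀ r : R, v.valuation L (D (ι r)) ≤ c) →
      ∀ o : O, v.valuation L (D (algebraMap O L o)) ≤ c := by
    intro D c hc o
    obtain ⟨⟨r, s⟩, hrs⟩ := IsLocalization.surj 𝔭.primeCompl o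
    have h1 : algebraMap O L o * ι s = ι r := by
      rw [hιO, hιO, ← map_mul, hrs]
    have h2 := hc r
    rw [← h1, Derivation.leibniz, smul_eq_mul, smul_eq_mul] at h2
    have h3 : v.valuation L (algebraMap O L o * D (ι s)) ≤ c := by
      rw [map_mul]
      exact (mul_le_mul' (hOle o) (hc s)).trans (one_mul _).le
    have h4 := Valuation.map_sub_le _ h2 h3
    rwa [add_sub_cancel_left, map_mul, hunit s s.2, one_mul] at h4
  have hCharK : CharZero K := by
    have : CharZero R := inferInstance
    exact charZero_of_injective_algebraMap (IsFractionRing.injective R K)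
  -- the fundamental identity
  have hsum : ∑ j, ι (X (some j)) * x j = (1 - T) * df + T * dg := by
    have hfe := congrArg (aeval x) hf.sum_X_mul_pderiv
    have hge := congrArg (aeval x) hg.sum_X_mul_pderiv
    simp only [map_sum, map_mul, aeval_X, nsmul_eq_mul, map_natCast] at hfe hge
    calc ∑ j, ι (X (some j)) * x j
        = (1 - T) * ((∑ j, x j * aeval x (pderiv j f)) / aeval x f) +
          T * ((∑ j, x j * aeval x (pderiv j g)) / aeval x g) := by
          rw [Finset.sum_div, Finset.sum_div, Finset.mul_sum, Finset.mul_sum,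
            ← Finset.sum_add_distrib]
          exact Finset.sum_congr rfl fun j _ => by rw [hx]; ring
      _ = _ := by rw [hfe, hge, mul_div_cancel_right₀ _ hfx, mul_div_cancel_right₀ _ hgx]
  have hder : ∀ D : Derivation ℂ L L, ∑ j, ι (X (some j)) * D (x j) =
      (1 - T) * (D (aeval x f) / aeval x f) + T * (D (aeval x g) / aeval x g) := by
    intro D
    rw [D.map_mvPolynomial_aeval, D.map_mvPolynomial_aeval, Finset.sum_div, Finset.sum_div,
      Finset.mul_sum, Finset.mul_sum, ← Finset.sum_add_distrib]
    exact Finset.sum_congr rfl fun j _ => by rw [hx]; ring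
  have hmain : ∀ D : Derivation ℂ L L, ∑ j, x j * D (ι (X (some j))) +
      ((1 - T) * (D (aeval x f) / aeval x f) + T * (D (aeval x g) / aeval x g)) =
        D T * ((dg : L) - df) := by
    intro D
    have h := congrArg D hsum
    simp only [map_sum, map_add, Derivation.leibniz, smul_eq_mul, map_sub, D.map_natCast,
      D.map_one_eq_zero, Finset.sum_add_distrib] at h
    rw [hder] at h
    linear_combination h
  have hlog : ∀ D : Derivation ℂ L L, (∀ r : R, v.valuation L (D (ι r)) ≤ 1) →
      v.valuation L (D T / T) ≤ 1 → ∀ y : L, y ≠ 0 → v.valuation L (D y / y) ≤ 1 :=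
    fun D h1 h2 y hy => valuation_logDeriv_le_one hO v D (hquot D 1 h1) (Units.mk0 T hT0) hTlt h2
      (Units.mk0 y hy)
  refine ⟨fun j => ?_, ?_⟩
  · obtain ⟨D, hD⟩ := Derivation.exists_extension_of_isAlgebraic (K := K) (L := L)
      (pderiv (some j) : Derivation ℂ R R)
    have hDT : D T = 0 := by rw [hT, hD, pderiv_X_of_ne (by simp), map_zero]
    have hle := hlog D (fun r => by rw [hD]; exact hRle _) (by simp [hDT])
    have h := hmain D
    have hs : ∑ i, x i * D (ι (X (some i))) = x j := by
      rw [Finset.sum_eq_single j]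
      · rw [hD, pderiv_X_self, map_one, mul_one]
      · intro i _ hij
        rw [hD, pderiv_X_of_ne (by simpa using hij), map_zero, mul_zero]
      · simp
    rw [hs, hDT, zero_mul, add_eq_zero_iff_eq_neg] at h
    rw [h, Valuation.map_neg]
    refine Valuation.map_add_le _ ?_ ?_
    · rw [map_mul]
      refine mul_le_one' ?_ (hle _ hfx)
      have := hRle (1 - X none)
      rwa [map_sub, map_one] at this
    · rw [map_mul]
      exact mul_le_one' hTlt.le (hle _ hgx)
  · obtain ⟨D, hD⟩ := Derivation.exists_extension_of_isAlgebraic (K := K) (L := L)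
      ((X none : R) • pderiv none : Derivation ℂ R R)
    have hDT : D T = T := by
      rw [hT, hD, Derivation.smul_apply, pderiv_X_self, smul_eq_mul, mul_one]
    have hDR : ∀ r : R, v.valuation L (D (ι r)) < 1 := by
      intro r
      rw [hD, Derivation.smul_apply, smul_eq_mul, map_mul, map_mul]
      exact mul_lt_one_of_lt_of_le hTlt (hRle _)
    have hle := hlog D (fun r => (hDR r).le) (by rw [hDT, div_self hT0, map_one])
    have h := hmain D
    have hs : ∑ i, x i * D (ι (X (some i))) = 0 := by
      refine Finset.sum_eq_zero fun i _ => ?_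
      rw [hD, Derivation.smul_apply, pderiv_X_of_ne (by simp), smul_zero, map_zero, mul_zero]
    rw [hs, hDT, zero_add, ← eq_sub_iff_add_eq, ← mul_sub] at h
    have hlt : v.valuation L (D (aeval x f) / aeval x f) < 1 := by
      have h1 : v.valuation L (1 - T) = 1 := Valuation.map_one_sub_of_lt _ hTlt
      have h2 := congrArg (v.valuation L) h
      rw [map_mul, h1, one_mul, map_mul] at h2
      rw [h2]
      refine mul_lt_one_of_lt_of_le hTlt (Valuation.map_sub_le _ ?_ (hle _ hgx))
      have := hRle ((dg : R) - df)
      rwa [map_sub, map_natCast, map_natCast] at this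
    exact valuation_eq_one_of_euler_lt_one hO v D
      (fun y => hle y y.ne_zero)
      (fun o => by
        rw [lt_one_iff_le_exp_neg_one]
        exact hquot D _ (fun r => (lt_one_iff_le_exp_neg_one _).1 (hDR r)) o)
      (Units.mk0 T hT0) hDT (Units.mk0 _ hfx) hlt

end GradientFamily

section RankSpecialization

/-- The rank of a module with a torsion quotient by a finitely generated free submodule. -/
lemma finrank_eq_card_of_torsion_quotient {R M ι : Type*} [CommRing R] [IsDomain R]
    [AddCommGroup M] [Module R M] [Fintype ι] {b : ι → M} (hb : LinearIndependent R b)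
    (h : ∀ a, ∃ s : R, s ≠ 0 ∧ s • a ∈ Submodule.span R (Set.range b)) :
    Module.finrank R M = Fintype.card ι := by
  have h1 := rank_quotient_add_rank_of_isDomain (Submodule.span R (Set.range b))
  have h2 : Module.rank R (M ⧸ Submodule.span R (Set.range b)) = 0 := by
    rw [rank_eq_zero_iff]
    intro x
    obtain ⟨a, rfl⟩ := Submodule.Quotient.mk_surjective _ x
    obtain ⟨s, hs, hsa⟩ := h a
    exact ⟨s, hs, by rwa [← Submodule.Quotient.mk_smul, Submodule.Quotient.mk_eq_zero]⟩
  rw [h2, zero_add] at h1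
  rw [← finrank_span_eq_card hb, Module.finrank, Module.finrank, h1]

/-- The rank does not change on passing to the quotient by a principal prime `t`, provided that the
module is generated by a linearly independent family after localizing at `t`. -/
lemma finrank_eq_finrank_of_specialization {R R₀ M M₀ ι : Type*} [CommRing R] [IsDomain R]
    [CommRing R₀] [IsDomain R₀] [AddCommGroup M] [Module R M] [AddCommGroup M₀] [Module R₀ M₀]
    [Fintype ι] {ρ : R →+* R₀} (hρ : Function.Surjective ρ) {t : R}
    (hker : ∀ r, ρ r = 0 ↔ t ∣ r) (α : M →ₛₗ[ρ] M₀) (hα : Function.Surjective α)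
    (hαker : ∀ a, α a = 0 → ∃ a', a = t • a') {b : ι → M} (hb : LinearIndependent R b)
    (h : ∀ a, ∃ s : R, ρ s ≠ 0 ∧ s • a ∈ Submodule.span R (Set.range b)) :
    Module.finrank R M = Module.finrank R₀ M₀ := by
  have hM := finrank_eq_card_of_torsion_quotient hb fun a => by
    obtain ⟨s, hs, hsa⟩ := h a
    exact ⟨s, fun h0 => hs (by rw [h0, map_zero]), hsa⟩
  have hb₀ : LinearIndependent R₀ (fun i => α (b i)) := by
    rw [Fintype.linearIndependent_iff]
    intro c hc i
    choose r hr using fun i => hρ (c i)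
    have h0 : α (∑ i, r i • b i) = 0 := by
      rw [map_sum, ← hc]
      exact Finset.sum_congr rfl fun i _ => by rw [map_smulₛₗ, hr]
    obtain ⟨a, ha⟩ := hαker _ h0
    obtain ⟨s, hs, hsa⟩ := h a
    obtain ⟨r', hr'⟩ := (Submodule.mem_span_range_iff_exists_fun R).1 hsa
    have h1 : ∑ i, (s * r i - t * r' i) • b i = 0 := by
      simp only [sub_smul, mul_smul, Finset.sum_sub_distrib, ← Finset.smul_sum, ha, hr']
      rw [smul_comm, sub_self]
    have h2 := Fintype.linearIndependent_iff.1 hb _ h1 i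
    have h3 : ρ (s * r i) = 0 := (hker _).2 ⟨r' i, sub_eq_zero.1 h2⟩
    rw [map_mul, hr] at h3
    exact (mul_eq_zero.1 h3).resolve_left hs
  rw [hM, finrank_eq_card_of_torsion_quotient hb₀ fun a₀ => ?_]
  obtain ⟨a, rfl⟩ := hα a₀
  obtain ⟨s, hs, hsa⟩ := h a
  obtain ⟨r, hr⟩ := (Submodule.mem_span_range_iff_exists_fun R).1 hsa
  refine ⟨ρ s, hs, (Submodule.mem_span_range_iff_exists_fun R₀).2 ⟨fun i => ρ (r i), ?_⟩⟩
  rw [← map_smulₛₗ, ← hr, map_sum]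
  exact Finset.sum_congr rfl fun i _ => by rw [map_smulₛₗ]

/-- If the localization of a submodule at a prime generates a finitely generated torsion-free module
over a principal ideal domain, the submodule has a basis up to denominators. -/
lemma exists_linearIndependent_of_localization_fg {R O M L : Type*} [CommRing R] [IsDomain R]
    [CommRing O] [IsDomain O] [IsPrincipalIdealRing O] [Algebra R O] (S : Submonoid R)
    (hS : S ≤ nonZeroDivisors R) [IsLocalization S O] [AddCommGroup M] [Module R M]
    [AddCommGroup L] [Module R L] [Module O L] [IsScalarTower R O L] [Module.IsTorsionFree O L]
    (i : M →ₗ[R] L) (hi : Function.Injective i)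
    (hfg : (Submodule.span O (Set.range i)).FG) :
    ∃ (d : ℕ) (b : Fin d → M), LinearIndependent R b ∧
      ∀ a, ∃ s ∈ S, s • a ∈ Submodule.span R (Set.range b) := by
  set N := Submodule.span O (Set.range i) with hN
  have : Module.Finite O N := Module.Finite.iff_fg.2 hfg
  obtain ⟨d, e⟩ := Module.basisOfFiniteTypeTorsionFree' (R := O) (M := N)
  have hmem : ∀ y ∈ N, ∃ s ∈ S, ∃ a, i a = s • y := by
    intro y hy
    induction hy using Submodule.span_induction with
    | mem y hy => obtain ⟨a, rfl⟩ := hy; exact ⟨1, S.one_mem, a, (one_smul _ _).symm⟩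
    | zero => exact ⟨1, S.one_mem, 0, by simp⟩
    | add y z _ _ hy hz =>
      obtain ⟨s, hs, a, ha⟩ := hy
      obtain ⟨s', hs', a', ha'⟩ := hz
      refine ⟨s * s', S.mul_mem hs hs', s' • a + s • a', ?_⟩
      rw [map_add, map_smul, map_smul, ha, ha', smul_add, mul_comm s s', mul_smul, mul_comm s' s,
        mul_smul]
    | smul o y _ hy =>
      obtain ⟨s, hs, a, ha⟩ := hy
      obtain ⟨⟨r, s'⟩, hrs⟩ := IsLocalization.surj S o
      refine ⟨s' * s, S.mul_mem s'.2 hs, r • a, ?_⟩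
      rw [map_smul, ha, ← algebraMap_smul O r (s • y), ← hrs, mul_comm o, mul_smul, mul_smul,
        algebraMap_smul O (s' : R), smul_comm o s y]
  choose s hs b hb using fun k => hmem (e k) (e k).2
  have hunit : ∀ k, IsUnit (algebraMap R O (s k)) := fun k =>
    IsLocalization.map_units O (⟨s k, hs k⟩ : S)
  have hbO : LinearIndependent O (fun k => i (b k)) := by
    have h1 : LinearIndependent O (fun k => (e k : L)) :=
      e.linearIndependent.map' N.subtype N.ker_subtype
    have h2 := h1.units_smul (fun k => (hunit k).unit)
    convert h2 using 1
    funext k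
    rw [hb, ← algebraMap_smul O]
    rfl
  have hbR : LinearIndependent R b := by
    have h1 : LinearIndependent R (fun k => i (b k)) := by
      refine hbO.restrict_scalars ?_
      intro x y hxy
      simp only [Algebra.smul_def, mul_one] at hxy
      exact IsLocalization.injective O hS hxy
    exact LinearIndependent.of_comp i h1
  refine ⟨d, b, hbR, fun a => ?_⟩
  set y : N := ⟨i a, Submodule.subset_span ⟨a, rfl⟩⟩ with hy
  obtain ⟨u, hu⟩ := IsLocalization.exist_integer_multiples_of_finite S
    (fun k => e.repr y k * ((hunit k).unit⁻¹ : Oˣ))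
  choose r hr using hu
  refine ⟨u, u.2, (Submodule.mem_span_range_iff_exists_fun R).2 ⟨r, hi ?_⟩⟩
  have h1 : i a = ∑ k, e.repr y k • (e k : L) := by
    have := congrArg N.subtype (e.sum_repr y)
    rw [map_sum] at this
    exact this.symm
  rw [map_sum, map_smul, h1, Finset.smul_sum]
  refine Finset.sum_congr rfl fun k _ => ?_
  rw [map_smul, hb, ← algebraMap_smul O (r k), hr, ← algebraMap_smul O (s k), smul_assoc,
    ← mul_smul, mul_assoc, IsUnit.val_inv_mul, mul_one]

end RankSpecialization

section GenericBasis

open IsDedekindDomain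

/-- A Noetherian domain localized at a nonzero principal prime ideal is a principal ideal ring. -/
lemma isPrincipalIdealRing_of_atPrime_span_singleton {R O : Type*} [CommRing R] [IsDomain R]
    [IsNoetherianRing R] [CommRing O] [IsDomain O] [Algebra R O] (t : R)
    [(Ideal.span {t}).IsPrime] [IsLocalization.AtPrime O (Ideal.span {t})] :
    IsPrincipalIdealRing O := by
  have := IsLocalization.isNoetherianRing (Ideal.span {t}).primeCompl O inferInstance
  have := IsLocalization.AtPrime.isLocalRing O (Ideal.span {t})
  refine ((tfae_of_isNoetherianRing_of_isLocalRing_of_isDomain O).out 0 4).2 ?_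
  rw [← IsLocalization.AtPrime.map_eq_maximalIdeal (Ideal.span {t}) O, Ideal.map_span,
    Set.image_singleton]
  exact ⟨⟨_, rfl⟩⟩

/-- The algebra generated by the solutions `x` of `(1 - t) ∇f(x)/f(x) + t ∇g(x)/g(x) = u` has a
basis up to denominators prime to `t`. -/
lemma exists_linearIndependent_of_gradient_family {τ A : Type*} [Fintype τ] [CommRing A]
    [IsDomain A] [Algebra ℂ A] [Algebra (MvPolynomial (Option τ) ℂ) A]
    [IsScalarTower ℂ (MvPolynomial (Option τ) ℂ) A] [FaithfulSMul (MvPolynomial (Option τ) ℂ) A]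
    [Algebra.IsAlgebraic (MvPolynomial (Option τ) ℂ) A]
    [(Ideal.span {(X none : MvPolynomial (Option τ) ℂ)}).IsPrime]
    {df dg : ℕ} {f g : MvPolynomial τ ℂ} (hf : f.IsHomogeneous df) (hg : g.IsHomogeneous dg)
    (x : τ → A) (y z : A) (hy : aeval x f * y = 1) (hz : aeval x g * z = 1)
    (hgen : Algebra.adjoin ℂ
      (Set.range x ∪ {y, algebraMap (MvPolynomial (Option τ) ℂ) A (X none)}) = ⊤)
    (hx : ∀ j, algebraMap (MvPolynomial (Option τ) ℂ) A (X (some j)) =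
      (1 - algebraMap (MvPolynomial (Option τ) ℂ) A (X none)) * (aeval x (pderiv j f) * y) +
        algebraMap (MvPolynomial (Option τ) ℂ) A (X none) * (aeval x (pderiv j g) * z)) :
    ∃ (d : ℕ) (b : Fin d → A), LinearIndependent (MvPolynomial (Option τ) ℂ) b ∧
      ∀ a, ∃ s ∈ (Ideal.span {(X none : MvPolynomial (Option τ) ℂ)}).primeCompl,
        s • a ∈ Submodule.span (MvPolynomial (Option τ) ℂ) (Set.range b) := by
  set R := MvPolynomial (Option τ) ℂ with hR
  set 𝔭 := Ideal.span {(X none : R)} with h𝔭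
  let O := Localization.AtPrime 𝔭
  let L := FractionRing A
  have hRL : Function.Injective (algebraMap R L) := by
    rw [IsScalarTower.algebraMap_eq R A L]
    exact (IsFractionRing.injective A L).comp (FaithfulSMul.algebraMap_injective R A)
  have hle : 𝔭.primeCompl ≤ nonZeroDivisors R := 𝔭.primeCompl_le_nonZeroDivisors
  have : FaithfulSMul R L := (faithfulSMul_iff_algebraMap_injective R L).2 hRL
  let K := FractionRing R
  let : Algebra K L := FractionRing.liftAlgebra R L
  have : IsScalarTower R K L := FractionRing.isScalarTower_liftAlgebra R L
  have : IsFractionRing O K :=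
    IsFractionRing.isFractionRing_of_isDomain_of_isLocalization 𝔭.primeCompl O K
  let : Algebra O L := ((algebraMap K L).comp (algebraMap O K)).toAlgebra
  have : IsScalarTower O K L := .of_algebraMap_eq fun _ => rfl
  have : IsScalarTower R O L := .of_algebraMap_eq fun r => by
    rw [IsScalarTower.algebraMap_apply O K L, ← IsScalarTower.algebraMap_apply R O K,
      ← IsScalarTower.algebraMap_apply R K L]
  have hOL : Function.Injective (algebraMap O L) :=
    (algebraMap K L).injective.comp (IsFractionRing.injective O K)
  have : FaithfulSMul O L := (faithfulSMul_iff_algebraMap_injective O L).2 hOL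
  have : IsPrincipalIdealRing O :=
    isPrincipalIdealRing_of_atPrime_span_singleton (X none : R)
  have := IsLocalization.isAlgebraic L (nonZeroDivisors A)
  have hRAL : Algebra.IsAlgebraic R L := .trans R A L
  have : Algebra.IsAlgebraic K L := .extendScalars (IsFractionRing.injective R K)
  have hfin : Module.Finite K L := by
    have : Algebra.FiniteType ℂ A := ⟨by
      rw [← hgen]
      exact Subalgebra.fg_def.2 ⟨_, (Set.finite_range x).union (Set.toFinite _), rfl⟩⟩
    have : Algebra.FiniteType R A := .of_restrictScalars_finiteType ℂ R A
    have : Algebra.EssFiniteType R L := .comp R A L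
    have : Algebra.EssFiniteType K L := .of_comp R K L
    exact Algebra.finite_of_essFiniteType_of_isAlgebraic
  have : CharZero K := charZero_of_injective_algebraMap (IsFractionRing.injective R K)
  let C := integralClosure O L
  have : IsDedekindDomain C := integralClosure.isDedekindDomain O K L
  have : Module.Finite O C := IsIntegralClosure.finite O K L C
  have : IsFractionRing C L := IsIntegralClosure.isFractionRing_of_finite_extension O K L C
  have hAL : ∀ p : MvPolynomial τ ℂ, aeval (fun j => algebraMap A L (x j)) p =
      algebraMap A L (aeval x p) := fun p => (aeval_algebraMap_apply L x p)
  have hfy : aeval (fun j => algebraMap A L (x j)) f * algebraMap A L y = 1 := by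
    rw [hAL, ← map_mul, hy, map_one]
  have hgz : aeval (fun j => algebraMap A L (x j)) g * algebraMap A L z = 1 := by
    rw [hAL, ← map_mul, hz, map_one]
  have hval := fun v : HeightOneSpectrum C => valuation_solution (O := O) (L := L) K v hf hg
    (fun j => algebraMap A L (x j)) (left_ne_zero_of_mul_eq_one hfy)
    (left_ne_zero_of_mul_eq_one hgz) (fun j => by
      rw [IsScalarTower.algebraMap_apply R A L, hx, div_eq_mul_inv, div_eq_mul_inv,
        ← eq_inv_of_mul_eq_one_right hfy, ← eq_inv_of_mul_eq_one_right hgz, hAL, hAL,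
        IsScalarTower.algebraMap_apply R A L]
      simp only [map_add, map_mul, map_sub, map_one]
      rfl)
  have hmem : ∀ a : A, ∃ c : C, algebraMap C L c = algebraMap A L a := by
    intro a
    have ha : a ∈ Algebra.adjoin ℂ (Set.range x ∪ {y, algebraMap R A (X none)}) := by
      rw [hgen]; trivial
    induction ha using Algebra.adjoin_induction with
    | mem a ha =>
      rcases ha with ⟨j, rfl⟩ | rfl | rfl
      · exact HeightOneSpectrum.mem_integers_of_valuation_le_one (R := C) L _ fun v => (hval v).1 j
      · refine HeightOneSpectrum.mem_integers_of_valuation_le_one (R := C) L _ fun v => ?_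
        rw [eq_inv_of_mul_eq_one_right hfy, map_inv₀, (hval v).2, inv_one]
      · refine ⟨algebraMap O C (algebraMap R O (X none)), ?_⟩
        rw [← IsScalarTower.algebraMap_apply O C L, ← IsScalarTower.algebraMap_apply R O L,
          IsScalarTower.algebraMap_apply R A L]
    | algebraMap c =>
      refine ⟨algebraMap O C (algebraMap R O (algebraMap ℂ R c)), ?_⟩
      rw [← IsScalarTower.algebraMap_apply O C L, ← IsScalarTower.algebraMap_apply R O L,
          IsScalarTower.algebraMap_apply R A L, ← IsScalarTower.algebraMap_apply ℂ R A]
    | add a b _ _ ha hb =>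
      obtain ⟨⟨c, hc⟩, c', hc'⟩ := And.intro ha hb
      exact ⟨c + c', by rw [(algebraMap C L).map_add, hc, hc', (algebraMap A L).map_add]⟩
    | mul a b _ _ ha hb =>
      obtain ⟨⟨c, hc⟩, c', hc'⟩ := And.intro ha hb
      exact ⟨c * c', by rw [(algebraMap C L).map_mul, hc, hc', (algebraMap A L).map_mul]⟩
  have : Module.IsTorsionFree O L := (Module.isTorsionFree_iff_algebraMap_injective).2 hOL
  refine exists_linearIndependent_of_localization_fg (O := O) 𝔭.primeCompl hle
    (IsScalarTower.toAlgHom R A L).toLinearMap (IsFractionRing.injective A L) ?_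
  have hC : (LinearMap.range (IsScalarTower.toAlgHom O C L).toLinearMap).FG := by
    rw [LinearMap.range_eq_map]
    exact (Module.finite_def.1 inferInstance).map _
  refine hC.of_le (Submodule.span_le.2 ?_)
  rintro _ ⟨a, rfl⟩
  exact hmem a

end GenericBasis

section Transcendence

/-- An extension of domains of equal finite transcendence degree is algebraic. -/
lemma isAlgebraic_of_trdeg_eq.{u} {k R A : Type u} [Field k] [CommRing R] [IsDomain R]
    [CommRing A] [IsDomain A] [Algebra k R] [Algebra k A] [Algebra R A] [IsScalarTower k R A]
    [FaithfulSMul R A] (h : Algebra.trdeg k R = Algebra.trdeg k A)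
    (hfin : Algebra.trdeg k A < Cardinal.aleph0) :
    Algebra.IsAlgebraic R A := by
  have h1 := trdeg_add_eq k R (A := A)
  rw [h] at h1
  rw [← trdeg_eq_zero_iff]
  exact Cardinal.eq_of_add_eq_add_left (by rw [h1, add_zero]) hfin

lemma trdeg_of_isLocalizationAway.{u} {τ k A : Type u} [Field k] [CommRing A] [IsDomain A]
    [Algebra k A] [Algebra (MvPolynomial τ k) A] [IsScalarTower k (MvPolynomial τ k) A]
    {f : MvPolynomial τ k} (hf : f ≠ 0) [IsLocalization.Away f A] :
    Algebra.trdeg k A = Cardinal.mk τ := by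
  have : FaithfulSMul (MvPolynomial τ k) A := (faithfulSMul_iff_algebraMap_injective _ _).2
    (IsLocalization.injective A (powers_le_nonZeroDivisors_of_noZeroDivisors hf))
  have : Algebra.IsAlgebraic (MvPolynomial τ k) A :=
    IsLocalization.isAlgebraic A (Submonoid.powers f)
  have h1 := trdeg_add_eq k (MvPolynomial τ k) (A := A)
  rw [trdeg_eq_zero (R := MvPolynomial τ k), add_zero, MvPolynomial.trdeg_of_isDomain,
    Cardinal.lift_id] at h1
  exact h1.symm

end Transcendence

section RingHomRank

/-- The generic rank of a ring homomorphism. -/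
def RingHom.genericRank {R A : Type*} [CommRing R] [CommRing A] (φ : R →+* A) : ℕ :=
  letI := φ.toAlgebra
  Module.finrank R A

lemma RingHom.genericRank_eq_zero {R A : Type*} [CommRing R] [IsDomain R] [CommRing A]
    {φ : R →+* A} (h : ¬ Function.Injective φ) : φ.genericRank = 0 := by
  let := φ.toAlgebra
  obtain ⟨r, hr, hr0⟩ : ∃ r, φ r = 0 ∧ r ≠ 0 := by
    by_contra! h'
    exact h ((injective_iff_map_eq_zero φ).2 h')
  refine Module.finrank_eq_zero_of_rank_eq_zero (rank_eq_zero_iff.2 fun x => ⟨r, hr0, ?_⟩)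
  rw [Algebra.smul_def, RingHom.algebraMap_toAlgebra, hr, zero_mul]

lemma RingHom.genericRank_comp_equiv {R R' A A' : Type*} [CommRing R] [CommRing R'] [CommRing A]
    [CommRing A'] {φ : R →+* A} {φ' : R' →+* A'} (e : R ≃+* R') (e' : A ≃+* A')
    (h : ∀ r, e' (φ r) = φ' (e r)) : φ.genericRank = φ'.genericRank := by
  let := φ.toAlgebra
  let := φ'.toAlgebra
  have := lift_rank_eq_of_equiv_equiv (e : ZeroHom R R') e'.toAddEquiv e.bijective
    fun r x => by
      simp only [Algebra.smul_def, RingHom.algebraMap_toAlgebra]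
      exact (map_mul e' _ _).trans (by rw [h]; rfl)
  simpa [RingHom.genericRank, Module.finrank] using congrArg Cardinal.toNat this

lemma RingHom.genericRank_eq_of_specialization {R R₀ A A₀ ι : Type*} [Fintype ι] [CommRing R]
    [IsDomain R] [CommRing R₀] [IsDomain R₀] [CommRing A] [IsDomain A] [CommRing A₀] [IsDomain A₀]
    (φ : R →+* A) (φ₀ : R₀ →+* A₀) {ρ : R →+* R₀} (hρ : Function.Surjective ρ) {t : R}
    (hker : ∀ r, ρ r = 0 ↔ t ∣ r) (α : A →+* A₀) (hα : Function.Surjective α)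
    (hαker : ∀ a, α a = 0 → φ t ∣ a) (hcomm : ∀ r, α (φ r) = φ₀ (ρ r)) {b : ι → A}
    (hb : letI := φ.toAlgebra; LinearIndependent R b)
    (h : letI := φ.toAlgebra; ∀ a, ∃ s, ρ s ≠ 0 ∧ s • a ∈ Submodule.span R (Set.range b)) :
    φ.genericRank = φ₀.genericRank := by
  let := φ.toAlgebra
  let := φ₀.toAlgebra
  let α' : A →ₛₗ[ρ] A₀ :=
    { toFun := α
      map_add' := map_add α
      map_smul' := fun r a => by
        simp only [Algebra.smul_def, RingHom.algebraMap_toAlgebra, map_mul, hcomm] }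
  exact finrank_eq_finrank_of_specialization hρ hker α' hα
    (fun a ha => (hαker a ha).imp fun c hc => by
      rw [hc, Algebra.smul_def, RingHom.algebraMap_toAlgebra]) hb h

end RingHomRank

section GradientFamilyRank

variable {τ : Type*} {A : Type*} [CommRing A] [Algebra ℂ A] [Algebra (MvPolynomial τ ℂ) A]

variable (A) in
/-- The logarithmic partial derivatives of `f` in an algebra in which `f` is invertible. -/
def logGrad (f : MvPolynomial τ ℂ) (j : τ) : A :=
  algebraMap _ A (pderiv j f) * Ring.inverse (algebraMap _ A f)

variable (A) in
/-- The comorphism of `x ↦ ∇f(x)/f(x)`. -/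
def logGradHom (f : MvPolynomial τ ℂ) : MvPolynomial τ ℂ →ₐ[ℂ] A :=
  aeval (logGrad A f)

variable (A) in
/-- The comorphism of `(x, t) ↦ ((1 - t) ∇f(x)/f(x) + t ∇g(x)/g(x), t)`. -/
def logGradFamily (f g : MvPolynomial τ ℂ) :
    MvPolynomial (Option τ) ℂ →ₐ[ℂ] Polynomial A :=
  aeval fun o => o.elim Polynomial.X fun j =>
    (1 - Polynomial.X) * Polynomial.C (logGrad A f j) + Polynomial.X * Polynomial.C (logGrad A g j)

/-- The specialization `t = 0`. -/
def specializeNone (τ : Type*) : MvPolynomial (Option τ) ℂ →ₐ[ℂ] MvPolynomial τ ℂ :=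
  aeval fun o => o.elim 0 X

@[simp] lemma logGradHom_X (f : MvPolynomial τ ℂ) (j : τ) :
    logGradHom A f (X j) = logGrad A f j := aeval_X _ _

@[simp] lemma logGradFamily_X_none (f g : MvPolynomial τ ℂ) :
    logGradFamily A f g (X none) = Polynomial.X := aeval_X _ _

@[simp] lemma logGradFamily_X_some (f g : MvPolynomial τ ℂ) (j : τ) :
    logGradFamily A f g (X (some j)) = (1 - Polynomial.X) * Polynomial.C (logGrad A f j) +
      Polynomial.X * Polynomial.C (logGrad A g j) := aeval_X _ _

@[simp] lemma specializeNone_X_none : specializeNone τ (X none) = 0 := aeval_X _ _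

@[simp] lemma specializeNone_X_some (j : τ) : specializeNone τ (X (some j)) = X j := aeval_X _ _

@[simp] lemma specializeNone_rename (p : MvPolynomial τ ℂ) :
    specializeNone τ (rename some p) = p := by
  rw [specializeNone, aeval_rename]
  exact aeval_X_left_apply p

lemma specializeNone_eq_zero_iff (r : MvPolynomial (Option τ) ℂ) :
    specializeNone τ r = 0 ↔ X none ∣ r := by
  have h : ∀ r : MvPolynomial (Option τ) ℂ, X none ∣ r - rename some (specializeNone τ r) := by
    intro r
    induction r using MvPolynomial.induction_on with
    | C a => simp [← algebraMap_eq]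
    | add p q hp hq => simpa [add_sub_add_comm] using dvd_add hp hq
    | mul_X p o hp =>
      rcases o with _ | j
      · simp
      · simpa [sub_mul] using Dvd.dvd.mul_right hp (X (some j))
  constructor
  · intro h0
    simpa [h0] using h r
  · rintro ⟨q, rfl⟩
    simp

lemma eval_logGradFamily (f g : MvPolynomial τ ℂ) (r : MvPolynomial (Option τ) ℂ) :
    (logGradFamily A f g r).eval 0 = logGradHom A f (specializeNone τ r) := by
  induction r using MvPolynomial.induction_on with
  | C a => simp [← algebraMap_eq]
  | add p q hp hq => simp [hp, hq]
  | mul_X p o hp =>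
    rcases o with _ | j <;> simp [hp]

variable (τ) in
/-- The automorphism `t ↦ 1 - t`. -/
def reflectNone : MvPolynomial (Option τ) ℂ ≃ₐ[ℂ] MvPolynomial (Option τ) ℂ :=
  .ofAlgHom (aeval fun o => o.elim (1 - X none) fun j => X (some j))
    (aeval fun o => o.elim (1 - X none) fun j => X (some j))
    (by ext o; rcases o with _ | j <;> simp) (by ext o; rcases o with _ | j <;> simp)

variable (A) in
/-- The automorphism `t ↦ 1 - t` of `A[t]`. -/
def reflectX : Polynomial A ≃ₐ[A] Polynomial A :=
  .ofAlgHom (Polynomial.aeval (1 - Polynomial.X)) (Polynomial.aeval (1 - Polynomial.X))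
    (by ext; simp) (by ext; simp)

lemma reflectX_logGradFamily (f g : MvPolynomial τ ℂ) (r : MvPolynomial (Option τ) ℂ) :
    reflectX A (logGradFamily A f g r) = logGradFamily A g f (reflectNone τ r) := by
  induction r using MvPolynomial.induction_on with
  | C a => simp [reflectNone, reflectX, logGradFamily]
  | add p q hp hq => simp only [map_add, hp, hq]
  | mul_X p o hp =>
    rw [map_mul, map_mul, hp, map_mul, map_mul]
    congr 1
    rcases o with _ | j
    · simp [reflectNone, reflectX, logGradFamily]
    · simp [reflectNone, reflectX, logGradFamily]
      ring

lemma genericRank_logGradFamily_symm (f g : MvPolynomial τ ℂ) :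
    (logGradFamily A f g).toRingHom.genericRank = (logGradFamily A g f).toRingHom.genericRank :=
  RingHom.genericRank_comp_equiv (reflectNone τ).toRingEquiv (reflectX A).toRingEquiv
    (reflectX_logGradFamily f g)

lemma exists_not_X_dvd_of_logGradFamily_eq_zero [IsDomain A] (f g : MvPolynomial τ ℂ)
    {r : MvPolynomial (Option τ) ℂ} (hr0 : r ≠ 0) (hr : logGradFamily A f g r = 0) :
    ∃ r', ¬ X none ∣ r' ∧ logGradFamily A f g r' = 0 := by
  obtain ⟨r', hr', hnd⟩ :=
    (FiniteMultiplicity.of_prime_left (X_prime (i := none)) hr0).exists_eq_pow_mul_and_not_dvd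
  refine ⟨r', hnd, ?_⟩
  rw [hr', map_mul, map_pow, logGradFamily_X_none] at hr
  exact (mul_eq_zero.1 hr).resolve_left (pow_ne_zero _ Polynomial.X_ne_zero)

lemma adjoin_polynomial_eq_top [IsScalarTower ℂ (MvPolynomial τ ℂ) A] {f : MvPolynomial τ ℂ}
    [IsLocalization.Away f A] :
    Algebra.adjoin ℂ (Set.range (fun j => Polynomial.C (algebraMap (MvPolynomial τ ℂ) A (X j))) ∪
      {Polynomial.C (Ring.inverse (algebraMap _ A f)), Polynomial.X}) = ⊤ := by
  set S := Algebra.adjoin ℂ (Set.range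
    (fun j => Polynomial.C (algebraMap (MvPolynomial τ ℂ) A (X j))) ∪
      {Polynomial.C (Ring.inverse (algebraMap _ A f)), Polynomial.X}) with hS
  have hunit : IsUnit (algebraMap _ A f) := IsLocalization.Away.algebraMap_isUnit f
  have hp : ∀ p : MvPolynomial τ ℂ, Polynomial.C (algebraMap _ A p) ∈ S := by
    intro p
    induction p using MvPolynomial.induction_on with
    | C a =>
      rw [← algebraMap_eq, ← IsScalarTower.algebraMap_apply ℂ (MvPolynomial τ ℂ) A]
      exact S.algebraMap_mem a
    | add p q hp hq => rw [map_add, map_add]; exact add_mem hp hq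
    | mul_X p j hp =>
      rw [map_mul, map_mul]
      exact mul_mem hp (Algebra.subset_adjoin (.inl ⟨j, rfl⟩))
  have hC : ∀ a : A, Polynomial.C a ∈ S := by
    intro a
    obtain ⟨m, p, hm⟩ := IsLocalization.Away.surj f a
    have : a = algebraMap _ A p * Ring.inverse (algebraMap _ A f) ^ m := by
      rw [← hm, mul_assoc, ← mul_pow, Ring.mul_inverse_cancel _ hunit, one_pow, mul_one]
    rw [this, map_mul, map_pow]
    exact mul_mem (hp p) (pow_mem (Algebra.subset_adjoin (.inr (.inl rfl))) m)
  refine eq_top_iff.2 fun q _ => ?_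
  induction q using Polynomial.induction_on' with
  | add p q hp hq => exact add_mem (hp trivial) (hq trivial)
  | monomial m a =>
    rw [← Polynomial.C_mul_X_pow_eq_monomial]
    exact mul_mem (hC a) (pow_mem (Algebra.subset_adjoin (.inr (.inr rfl))) m)

end GradientFamilyRank

section Comparison

variable {τ A : Type} [Fintype τ] [CommRing A] [IsDomain A] [Algebra ℂ A]
  [Algebra (MvPolynomial τ ℂ) A] [IsScalarTower ℂ (MvPolynomial τ ℂ) A]

lemma genericRank_logGradFamily_eq {df dg : ℕ} {f g : MvPolynomial τ ℂ} (hf0 : f ≠ 0)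
    (hf : f.IsHomogeneous df) (hg : g.IsHomogeneous dg) [IsLocalization.Away f A]
    (hgu : IsUnit (algebraMap _ A g)) :
    (logGradFamily A f g).toRingHom.genericRank = (logGradHom A f).toRingHom.genericRank := by
  by_cases hinj : Function.Injective (logGradFamily A f g)
  · have hfu : IsUnit (algebraMap _ A f) := IsLocalization.Away.algebraMap_isUnit f
    let : Algebra (MvPolynomial (Option τ) ℂ) (Polynomial A) :=
      (logGradFamily A f g).toRingHom.toAlgebra
    have hmap (r) : algebraMap (MvPolynomial (Option τ) ℂ) (Polynomial A) r =
      logGradFamily A f g r := rfl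
    have : IsScalarTower ℂ (MvPolynomial (Option τ) ℂ) (Polynomial A) :=
      .of_algebraMap_eq fun c => ((logGradFamily A f g).commutes c).symm
    have : FaithfulSMul (MvPolynomial (Option τ) ℂ) (Polynomial A) :=
      (faithfulSMul_iff_algebraMap_injective _ _).2 hinj
    have htr : Algebra.trdeg ℂ (Polynomial A) = Cardinal.mk (Option τ) := by
      rw [← trdeg_add_eq ℂ A (A := Polynomial A), trdeg_of_isLocalizationAway hf0,
        Polynomial.trdeg_of_isDomain, Cardinal.mk_option]
    have : Algebra.IsAlgebraic (MvPolynomial (Option τ) ℂ) (Polynomial A) :=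
      isAlgebraic_of_trdeg_eq (k := ℂ)
        (by rw [htr, MvPolynomial.trdeg_of_isDomain, Cardinal.lift_id])
        (by rw [htr]; exact Cardinal.mk_lt_aleph0)
    have hX : Prime (X none : MvPolynomial (Option τ) ℂ) := X_prime
    have : (Ideal.span {(X none : MvPolynomial (Option τ) ℂ)}).IsPrime :=
      (Ideal.span_singleton_prime hX.ne_zero).2 hX
    have haeval (p : MvPolynomial τ ℂ) :
        aeval (fun j => Polynomial.C (algebraMap (MvPolynomial τ ℂ) A (X j))) p =
          Polynomial.C (algebraMap (MvPolynomial τ ℂ) A p) := by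
      induction p using MvPolynomial.induction_on with
      | C a =>
        rw [aeval_C, ← algebraMap_eq, ← IsScalarTower.algebraMap_apply ℂ (MvPolynomial τ ℂ) A]
        rfl
      | add p q hp hq => simp only [map_add, hp, hq]
      | mul_X p j hp => simp only [map_mul, hp, aeval_X]
    obtain ⟨d, b, hb, hspan⟩ := exists_linearIndependent_of_gradient_family
      (A := Polynomial A) hf hg
      (fun j => Polynomial.C (algebraMap (MvPolynomial τ ℂ) A (X j)))
      (Polynomial.C (Ring.inverse (algebraMap _ A f)))
      (Polynomial.C (Ring.inverse (algebraMap _ A g)))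
      (by rw [haeval, ← map_mul, Ring.mul_inverse_cancel _ hfu, map_one])
      (by rw [haeval, ← map_mul, Ring.mul_inverse_cancel _ hgu, map_one])
      (by rw [hmap, logGradFamily_X_none]; exact adjoin_polynomial_eq_top)
      (fun j => by
        rw [hmap, hmap, logGradFamily_X_none, logGradFamily_X_some, haeval, haeval,
          ← map_mul, ← map_mul]
        rfl)
    refine RingHom.genericRank_eq_of_specialization _ _
      (ρ := (specializeNone τ).toRingHom) (t := X none)
      (fun p => ⟨rename some p, specializeNone_rename p⟩) specializeNone_eq_zero_iff
      (Polynomial.evalRingHom 0) (fun a => ⟨Polynomial.C a, Polynomial.eval_C⟩)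
      (fun a ha => ?_) (eval_logGradFamily f g) hb (fun a => ?_)
    · change logGradFamily A f g (X none) ∣ a
      rw [logGradFamily_X_none, Polynomial.X_dvd_iff, Polynomial.coeff_zero_eq_eval_zero]
      exact ha
    · obtain ⟨s, hs, hs'⟩ := hspan a
      exact ⟨s, fun h0 => hs (Ideal.mem_span_singleton.2 ((specializeNone_eq_zero_iff s).1 h0)),
        hs'⟩
  · have hinj' : ¬ Function.Injective (logGradHom A f) := by
      intro h
      obtain ⟨r, hr, hr0⟩ : ∃ r, logGradFamily A f g r = 0 ∧ r ≠ 0 := by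
        by_contra! h'
        exact hinj ((injective_iff_map_eq_zero _).2 h')
      obtain ⟨r', hr', h0⟩ := exists_not_X_dvd_of_logGradFamily_eq_zero f g hr0 hr
      refine hr' ((specializeNone_eq_zero_iff r').1 ((map_eq_zero_iff _ h).1 ?_))
      rw [← eval_logGradFamily f g, h0, Polynomial.eval_zero]
    rw [RingHom.genericRank_eq_zero hinj, RingHom.genericRank_eq_zero hinj']

/-- The generic rank of the logarithmic gradient depends only on the open set `f ≠ 0`. -/
theorem genericRank_logGradHom_eq {df dg : ℕ} {f g : MvPolynomial τ ℂ} (hf0 : f ≠ 0) (hg0 : g ≠ 0)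
    (hf : f.IsHomogeneous df) (hg : g.IsHomogeneous dg) [IsLocalization.Away f A]
    [IsLocalization.Away g A] :
    (logGradHom A f).toRingHom.genericRank = (logGradHom A g).toRingHom.genericRank := by
  rw [← genericRank_logGradFamily_eq hf0 hf hg (IsLocalization.Away.algebraMap_isUnit g),
    genericRank_logGradFamily_symm,
    genericRank_logGradFamily_eq hg0 hg hf (IsLocalization.Away.algebraMap_isUnit f)]

end Comparison

section CountHoms

lemma exists_isIntegral_primitive_of_isFractionRing {R A : Type*} (K L : Type*) [CommRing R]
    [IsDomain R] [IsIntegrallyClosed R] [CharZero R] [CommRing A] [IsDomain A] [Algebra R A]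
    [FaithfulSMul R A] [Algebra.IsAlgebraic R A] [Algebra.FiniteType R A] [Field K] [Field L]
    [Algebra R K] [IsFractionRing R K] [Algebra A L] [IsFractionRing A L] [Algebra K L]
    [Algebra R L] [IsScalarTower R A L] [IsScalarTower R K L] :
    ∃ z : A, IsIntegral R z ∧ (minpoly R z).natDegree = Module.finrank K L ∧
      Polynomial.aeval z (Polynomial.derivative (minpoly R z)) ≠ 0 ∧
      ∀ a : A, ∃ s ≠ (0 : R), ∃ p : Polynomial R, s • a = Polynomial.aeval z p := by
  have := IsLocalization.isAlgebraic L (nonZeroDivisors A)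
  have hRAL : Algebra.IsAlgebraic R L := .trans R A L
  have : Algebra.IsAlgebraic K L := .extendScalars (IsFractionRing.injective R K)
  have hfin : Module.Finite K L := by
    have : Algebra.EssFiniteType A L := .of_isLocalization _ (nonZeroDivisors A)
    have : Algebra.EssFiniteType R L := .comp R A L
    have : Algebra.EssFiniteType K L := .of_comp R K L
    exact Algebra.finite_of_essFiniteType_of_isAlgebraic
  have : CharZero K := charZero_of_injective_algebraMap (IsFractionRing.injective R K)
  obtain ⟨w, hw⟩ := Field.exists_primitive_element K L
  obtain ⟨r₁, hr₁, a, ha⟩ : ∃ r ≠ (0 : R), ∃ a : A, algebraMap A L a = r • w := by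
    obtain ⟨⟨a, _, r, hr, rfl⟩, h⟩ := IsLocalization.surj
      (Algebra.algebraMapSubmonoid A (nonZeroDivisors R)) w
    refine ⟨r, nonZeroDivisors.ne_zero hr, a, ?_⟩
    rw [← h, Algebra.smul_def, mul_comm, IsScalarTower.algebraMap_apply R A L]
  obtain ⟨r₂, hr₂, hint⟩ := (Algebra.IsAlgebraic.isAlgebraic (R := R) a).exists_integral_multiple
  set z := r₂ • a with hz
  have hzw : algebraMap A L z = algebraMap R K (r₂ * r₁) • w := by
    rw [hz, algebraMap_smul, mul_smul, ← ha, Algebra.smul_def, Algebra.smul_def, map_mul,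
      ← IsScalarTower.algebraMap_apply]
  have hc : algebraMap R K (r₂ * r₁) ≠ 0 := by
    rw [Ne, FaithfulSMul.algebraMap_eq_zero_iff]
    exact mul_ne_zero hr₂ hr₁
  have htop : IntermediateField.adjoin K {algebraMap A L z} = ⊤ := by
    rw [eq_top_iff, ← hw, IntermediateField.adjoin_simple_le_iff]
    have : w = (algebraMap R K (r₂ * r₁))⁻¹ • algebraMap A L z := by
      rw [hzw, smul_smul, inv_mul_cancel₀ hc, one_smul]
    rw [this]
    exact IntermediateField.smul_mem _ (IntermediateField.mem_adjoin_simple_self K _)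
  have hmin := minpoly.isIntegrallyClosed_eq_field_fractions K L hint
  have hmap (p : Polynomial R) : Polynomial.aeval (algebraMap A L z) (p.map (algebraMap R K)) =
      algebraMap A L (Polynomial.aeval z p) := by
    rw [Polynomial.aeval_map_algebraMap, Polynomial.aeval_algebraMap_apply]
  refine ⟨z, hint, ?_, fun h0 => ?_, fun a => ?_⟩
  · rw [← (Field.primitive_element_iff_minpoly_natDegree_eq K (algebraMap A L z)).1 htop, hmin,
      (minpoly.monic hint).natDegree_map]
  · have hsep : (minpoly K (algebraMap A L z)).Separable :=
      (minpoly.irreducible (Algebra.IsIntegral.isIntegral _)).separable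
    refine hsep.aeval_derivative_ne_zero (minpoly.aeval K (algebraMap A L z)) ?_
    rw [hmin, Polynomial.derivative_map, hmap, h0, map_zero]
  · have hmem : algebraMap A L a ∈ IntermediateField.adjoin K {algebraMap A L z} := by
      rw [htop]; trivial
    rw [← IntermediateField.mem_toSubalgebra,
      IntermediateField.adjoin_simple_toSubalgebra_of_isAlgebraic
        (Algebra.IsAlgebraic.isAlgebraic _),
      Algebra.adjoin_singleton_eq_range_aeval] at hmem
    obtain ⟨q, hq⟩ := hmem
    obtain ⟨s, hs, h⟩ := IsLocalization.integerNormalization_spec (nonZeroDivisors R) q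
    refine ⟨s, nonZeroDivisors.ne_zero hs,
      IsLocalization.integerNormalization (nonZeroDivisors R) q, IsFractionRing.injective A L ?_⟩
    rw [Algebra.smul_def s a, map_mul, ← hmap, h, ← algebraMap_smul K s q,
      map_smul (Polynomial.aeval _), Algebra.smul_def, ← IsScalarTower.algebraMap_apply,
      ← IsScalarTower.algebraMap_apply]
    exact congrArg _ hq.symm

/-- A primitive element of a generically finite extension, chosen integral over the base. -/
lemma exists_isIntegral_primitive {R A : Type*} [CommRing R] [IsDomain R] [IsIntegrallyClosed R]
    [CharZero R] [CommRing A] [IsDomain A] [Algebra R A] [FaithfulSMul R A]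
    [Algebra.IsAlgebraic R A] [Algebra.FiniteType R A] :
    ∃ z : A, IsIntegral R z ∧ (minpoly R z).natDegree = Module.finrank R A ∧
      Polynomial.aeval z (Polynomial.derivative (minpoly R z)) ≠ 0 ∧
      ∀ a : A, ∃ s ≠ (0 : R), ∃ p : Polynomial R, s • a = Polynomial.aeval z p := by
  let := FractionRing.liftAlgebra R (FractionRing A)
  have := FractionRing.isScalarTower_liftAlgebra R (FractionRing A)
  rw [← IsFractionRing.finrank_eq R (FractionRing R) A (FractionRing A)]
  exact exists_isIntegral_primitive_of_isFractionRing (FractionRing R) (FractionRing A)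

/-- A homomorphism extends along a ring extension that becomes trivial after inverting an element
with invertible image. -/
lemma exists_comp_eq_of_forall_exists_pow_mul {B A k : Type*} [CommRing B] [CommRing A] [IsDomain A]
    [Field k] (ι : B →+* A) (hι : Function.Injective ι) (P : B)
    (hP : ∀ a, ∃ (m : ℕ) (b : B), ι P ^ m * a = ι b) (h₀ : B →+* k) (h : h₀ P ≠ 0) :
    ∃ h : A →+* k, h.comp ι = h₀ := by
  have hP0 : P ≠ 0 := by rintro rfl; exact h (map_zero _)
  have hιP : ι P ≠ 0 := (map_ne_zero_iff ι hι).2 hP0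
  let C := Localization.Away (ι P)
  let := ι.toAlgebra
  have hAC : Function.Injective (algebraMap A C) :=
    IsLocalization.injective C (powers_le_nonZeroDivisors_of_noZeroDivisors hιP)
  have hBC (b : B) : algebraMap B C b = algebraMap A C (ι b) :=
    IsScalarTower.algebraMap_apply B A C b
  have : IsLocalization.Away P C := by
    refine ⟨?_, fun c => ?_, fun {x y} hxy => ⟨1, ?_⟩⟩
    · rintro ⟨_, m, rfl⟩
      rw [hBC, map_pow, map_pow]
      exact (IsLocalization.Away.algebraMap_isUnit (ι P)).pow m
    · obtain ⟨m, a, hm⟩ := IsLocalization.Away.surj (ι P) c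
      obtain ⟨m', b, hb⟩ := hP a
      refine ⟨⟨b, ⟨P ^ (m + m'), _, rfl⟩⟩, ?_⟩
      rw [hBC, hBC, ← hb, map_mul, ← hm, map_pow, map_pow, map_pow]
      ring
    · rw [hBC, hBC] at hxy
      rw [hι (hAC hxy)]
  refine ⟨(IsLocalization.Away.lift P (S := C) (g := h₀) h.isUnit).comp (algebraMap A C), ?_⟩
  ext b
  simp only [RingHom.comp_apply, ← hBC, IsLocalization.Away.lift_eq]

/-- Over a general point, the number of points of a fibre is the generic rank. -/
theorem exists_forall_ncard_extension_eq_finrank {R A k : Type*} [CommRing R] [IsDomain R]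
    [IsIntegrallyClosed R] [CharZero R] [CommRing A] [IsDomain A] [Algebra R A] [FaithfulSMul R A]
    [Algebra.IsAlgebraic R A] [Algebra.FiniteType R A] [Field k] [IsAlgClosed k] :
    ∃ P ≠ (0 : R), ∀ χ : R →+* k, χ P ≠ 0 →
      {h : A →+* k | h.comp (algebraMap R A) = χ}.Finite ∧
      {h : A →+* k | h.comp (algebraMap R A) = χ}.ncard = Module.finrank R A := by
  obtain ⟨z, hint, hdeg, hder, hz⟩ := exists_isIntegral_primitive (R := R) (A := A)
  set Q := minpoly R z with hQ
  have hQm : Q.Monic := minpoly.monic hint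
  obtain ⟨T, hT⟩ := Algebra.FiniteType.out (R := R) (A := A)
  choose s hs p hp using hz
  obtain ⟨e, he, w, hw⟩ := (Algebra.IsAlgebraic.isAlgebraic (R := R)
    (Polynomial.aeval z (Polynomial.derivative Q))).exists_nonzero_dvd
      (mem_nonZeroDivisors_of_ne_zero hder)
  refine ⟨(∏ t ∈ T, s t) * (s w * e), mul_ne_zero (Finset.prod_ne_zero_iff.2 fun t _ => hs t)
    (mul_ne_zero (hs w) he), fun χ hχ => ?_⟩
  set P := (∏ t ∈ T, s t) * (s w * e) with hPdef
  have hχs (t) (ht : t ∈ T) : χ (s t) ≠ 0 := fun h0 => hχ <| by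
    rw [hPdef, map_mul, map_prod, Finset.prod_eq_zero ht h0, zero_mul]
  have hχe : χ (s w * e) ≠ 0 := fun h0 => hχ <| by rw [hPdef, map_mul, h0, mul_zero]
  have hsP (t) (ht : t ∈ T) : s t ∣ P := (Finset.dvd_prod_of_mem s ht).mul_right _
  clear_value P
  have hhom (h : A →+* k) (hh : h.comp (algebraMap R A) = χ) (q : Polynomial R) :
      h (Polynomial.aeval z q) = q.eval₂ χ (h z) := by
    rw [Polynomial.aeval_def, Polynomial.hom_eval₂, hh]
  have hsep : (Q.map χ).Separable := by
    have hdvd : Q ∣ Polynomial.derivative Q * p w - Polynomial.C (s w * e) := by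
      refine minpoly.isIntegrallyClosed_dvd hint ?_
      rw [map_sub, map_mul, ← hp, Polynomial.aeval_C, map_mul, hw, Algebra.smul_def]
      ring
    obtain ⟨u, hu⟩ := hdvd
    refine ⟨-Polynomial.C (χ (s w * e))⁻¹ * u.map χ, Polynomial.C (χ (s w * e))⁻¹ * (p w).map χ, ?_⟩
    have h1 := congrArg (Polynomial.map χ) hu
    simp only [Polynomial.map_sub, Polynomial.map_mul, Polynomial.map_C] at h1
    have h2 : Polynomial.C (χ (s w * e))⁻¹ * Polynomial.C (χ (s w * e)) = 1 := by
      rw [← Polynomial.C_mul, inv_mul_cancel₀ hχe, Polynomial.C_1]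
    rw [Polynomial.derivative_map]
    linear_combination Polynomial.C (χ (s w * e))⁻¹ * h1 + h2
  have hbij : Set.BijOn (fun h : A →+* k => h z) {h | h.comp (algebraMap R A) = χ}
      ((Q.map χ).rootSet k) := by
    have hroot (y : k) : y ∈ (Q.map χ).rootSet k ↔ Q.eval₂ χ y = 0 := by
      rw [Polynomial.mem_rootSet_of_ne (hQm.map χ).ne_zero, Polynomial.coe_aeval_eq_eval,
        Polynomial.eval_map]
    refine ⟨fun h hh => ?_, fun h hh h' hh' heq => ?_, fun y hy => ?_⟩
    · rw [hroot, ← hhom h hh, hQ, minpoly.aeval, map_zero]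
    · have hC (r : R) : h (algebraMap R A r) = h' (algebraMap R A r) :=
        (RingHom.congr_fun hh r).trans (RingHom.congr_fun hh' r).symm
      ext a
      have ha : a ∈ Algebra.adjoin R (T : Set A) := by rw [hT]; trivial
      induction ha using Algebra.adjoin_induction with
      | mem t ht =>
        refine mul_left_cancel₀ (hχs t ht) ?_
        calc χ (s t) * h t = h (s t • t) := by rw [Algebra.smul_def, map_mul, ← hh]; rfl
          _ = h' (s t • t) := by
            rw [hp, hhom h hh, hhom h' hh']
            exact congrArg (fun y => (p t).eval₂ χ y) heq
          _ = χ (s t) * h' t := by rw [Algebra.smul_def, map_mul, ← hh']; rfl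
      | algebraMap r => exact hC r
      | add a b _ _ ha hb => rw [map_add, map_add, ha, hb]
      | mul a b _ _ ha hb => rw [map_mul, map_mul, ha, hb]
    · rw [hroot] at hy
      let ι : AdjoinRoot Q →+* A := AdjoinRoot.lift (algebraMap R A) z (minpoly.aeval R z)
      have hιmk (q : Polynomial R) : ι (AdjoinRoot.mk Q q) = Polynomial.aeval z q :=
        AdjoinRoot.lift_mk _ _
      have hι : Function.Injective ι := by
        rw [injective_iff_map_eq_zero]
        intro b hb
        obtain ⟨q, rfl⟩ := AdjoinRoot.mk_surjective b
        rw [hιmk] at hb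
        exact AdjoinRoot.mk_eq_zero.2 (minpoly.isIntegrallyClosed_dvd hint hb)
      let h₀ : AdjoinRoot Q →+* k := AdjoinRoot.lift χ y hy
      have hιof (r : R) : ι (AdjoinRoot.of Q r) = algebraMap R A r := AdjoinRoot.lift_of _
      have hιroot : ι (AdjoinRoot.root Q) = z := AdjoinRoot.lift_root _
      have hden (a : A) : ∃ (m : ℕ) (b : AdjoinRoot Q), ι (AdjoinRoot.of Q P) ^ m * a = ι b := by
        rw [hιof]
        have ha : a ∈ Algebra.adjoin R (T : Set A) := by rw [hT]; trivial
        induction ha using Algebra.adjoin_induction with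
        | mem t ht =>
          obtain ⟨r, hr⟩ := hsP t ht
          refine ⟨1, AdjoinRoot.mk Q (Polynomial.C r * p t), ?_⟩
          rw [hιmk, map_mul, ← hp, Polynomial.aeval_C, pow_one, hr, map_mul, Algebra.smul_def]
          ring
        | algebraMap r => exact ⟨0, AdjoinRoot.of Q r, by rw [hιof, pow_zero, one_mul]⟩
        | add a b _ _ ha hb =>
          obtain ⟨⟨m, c, hc⟩, m', c', hc'⟩ := And.intro ha hb
          refine ⟨m + m', AdjoinRoot.of Q P ^ m' * c + AdjoinRoot.of Q P ^ m * c', ?_⟩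
          rw [map_add, map_mul, map_mul, ← hc, ← hc', map_pow, map_pow, hιof]
          ring
        | mul a b _ _ ha hb =>
          obtain ⟨⟨m, c, hc⟩, m', c', hc'⟩ := And.intro ha hb
          refine ⟨m + m', c * c', ?_⟩
          rw [map_mul, ← hc, ← hc']
          ring
      obtain ⟨h, hh⟩ := exists_comp_eq_of_forall_exists_pow_mul ι hι (AdjoinRoot.of Q P) hden h₀
        (by rwa [AdjoinRoot.lift_of])
      refine ⟨h, ?_, ?_⟩
      · ext r
        have h1 := RingHom.congr_fun hh (AdjoinRoot.of Q r)
        rwa [RingHom.comp_apply, hιof, AdjoinRoot.lift_of] at h1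
      · have h1 := RingHom.congr_fun hh (AdjoinRoot.root Q)
        rwa [RingHom.comp_apply, hιroot, AdjoinRoot.lift_root] at h1
  have hfin : ((Q.map χ).rootSet k).Finite := Polynomial.rootSet_finite _ _
  refine ⟨hbij.finite_iff_finite.2 hfin, ?_⟩
  rw [← hbij.injOn.ncard_image, hbij.image_eq, Set.ncard_eq_toFinset_card',
    Set.toFinset_card, Polynomial.card_rootSet_eq_natDegree hsep (IsAlgClosed.splits _),
    hQm.natDegree_map, hdeg]

end CountHoms

section HomogeneousScaling

lemma IsHomogeneous.eval_smul_eq_pow_mul {τ : Type*} {d : ℕ} {p : MvPolynomial τ ℂ}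
    (hp : p.IsHomogeneous d) (c : ℂ) (x : τ → ℂ) : eval (c • x) p = c ^ d * eval x p := by
  rw [eval_eq, eval_eq, Finset.mul_sum]
  refine Finset.sum_congr rfl fun m hm => ?_
  have hd : ∑ i ∈ m.support, m i = d := by
    have := hp (mem_support_iff.1 hm)
    rwa [Finsupp.weight_apply, Finsupp.sum, Finset.sum_congr rfl fun i _ => by
      rw [Pi.one_apply, smul_eq_mul, mul_one]] at this
  simp only [Pi.smul_apply, smul_eq_mul, mul_pow, Finset.prod_mul_distrib,
    Finset.prod_pow_eq_pow_sum, hd]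
  ring

lemma exists_rep_mk_eq_smul {x : Fin (n + 1) → ℂ} (hx : x ≠ 0) :
    ∃ c : ℂ, c ≠ 0 ∧ (Projectivization.mk ℂ x hx).rep = c • x := by
  obtain ⟨a, ha⟩ := Projectivization.exists_smul_eq_mk_rep ℂ x hx
  exact ⟨a, a.ne_zero, ha.symm⟩

lemma IsHomogeneous.eval_rep_mk_eq_zero_iff {d : ℕ} {p : MvPolynomial (Fin (n + 1)) ℂ}
    (hp : p.IsHomogeneous d) {x : Fin (n + 1) → ℂ} (hx : x ≠ 0) :
    eval (Projectivization.mk ℂ x hx).rep p = 0 ↔ eval x p = 0 := by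
  obtain ⟨c, hc, h⟩ := exists_rep_mk_eq_smul hx
  rw [h, IsHomogeneous.eval_smul_eq_pow_mul hp, mul_eq_zero]
  exact or_iff_right (pow_ne_zero _ hc)

lemma exists_eval_smul_ne_zero {τ : Type*} {P : MvPolynomial τ ℂ} {m : ℕ} {x : τ → ℂ}
    (hm : eval x (homogeneousComponent m P) ≠ 0) : ∃ s : ℂ, s ≠ 0 ∧ eval (s • x) P ≠ 0 := by
  let q : Polynomial ℂ := ∑ i ∈ Finset.range (P.totalDegree + 1),
    Polynomial.monomial i (eval x (homogeneousComponent i P))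
  have hq (s : ℂ) : q.eval s = eval (s • x) P := by
    conv_rhs => rw [← sum_homogeneousComponent P]
    rw [map_sum, Polynomial.eval_finsetSum]
    refine Finset.sum_congr rfl fun i _ => ?_
    rw [Polynomial.eval_monomial,
      IsHomogeneous.eval_smul_eq_pow_mul (homogeneousComponent_isHomogeneous i P), mul_comm]
  have hmem : m ∈ Finset.range (P.totalDegree + 1) := by
    by_contra h
    rw [Finset.mem_range, Nat.lt_succ_iff, not_le] at h
    exact hm (by rw [homogeneousComponent_eq_zero m P h, map_zero])
  have hq0 : q ≠ 0 := fun h0 => hm <| by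
    have := congrArg (Polynomial.coeff · m) h0
    simpa [q, Polynomial.finsetSum_coeff, Polynomial.coeff_monomial, Finset.sum_ite_eq',
      Finset.mem_range.1 hmem] using this
  by_contra! h
  refine mul_ne_zero Polynomial.X_ne_zero hq0 (Polynomial.funext fun s => ?_)
  rw [Polynomial.eval_mul, Polynomial.eval_X, Polynomial.eval_zero, hq]
  by_cases hs : s = 0
  · rw [hs, zero_mul]
  · rw [h s hs, mul_zero]

end HomogeneousScaling

section ZariskiDense

lemma isZariskiOpenDense_principalOpen {d : ℕ} {p : MvPolynomial (Fin (n + 1)) ℂ} (hp0 : p ≠ 0)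
    (hp : p.IsHomogeneous d) : IsZariskiOpenDense (principalOpen p) := by
  refine ⟨⟨{p}, fun g hg => ⟨d, by rwa [Set.mem_singleton_iff.1 hg]⟩, ?_⟩, fun W hW ⟨w, hw⟩ => ?_⟩
  · ext x
    simp [principalOpen]
  · obtain ⟨T, hT, hWT⟩ := hW
    have hw' : w ∉ Wᶜ := fun h => h hw
    rw [hWT] at hw'
    obtain ⟨g, hg, hgw⟩ : ∃ g ∈ T, eval w.rep g ≠ 0 := by
      by_contra! h
      exact hw' h
    have hg0 : g ≠ 0 := by
      rintro rfl
      exact hgw (map_zero _)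
    obtain ⟨x, hx⟩ : ∃ x, eval x (g * p * X 0) ≠ 0 := by
      by_contra! h
      exact mul_ne_zero (mul_ne_zero hg0 hp0) (X_ne_zero 0)
        (MvPolynomial.funext fun x => by rw [h x, map_zero])
    simp only [map_mul, eval_X] at hx
    have hx0 : x ≠ 0 := by
      rintro rfl
      simp at hx
    obtain ⟨m, hm⟩ := hT g hg
    refine ⟨Projectivization.mk ℂ x hx0,
      (IsHomogeneous.eval_rep_mk_eq_zero_iff hp hx0).not.2
        (right_ne_zero_of_mul (left_ne_zero_of_mul hx)), ?_⟩
    by_contra hxW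
    have hxW' : Projectivization.mk ℂ x hx0 ∈ Wᶜ := hxW
    rw [hWT] at hxW'
    exact left_ne_zero_of_mul (left_ne_zero_of_mul hx)
      ((IsHomogeneous.eval_rep_mk_eq_zero_iff hm hx0).1 (hxW' g hg))

lemma IsZariskiOpenDense.inter_nonempty {U V : Set (Proj n)} (hU : IsZariskiOpenDense U)
    (hV : IsZariskiOpenDense V) : (U ∩ V).Nonempty := by
  have huniv : IsZariskiClosed (Set.univ : Set (Proj n))ᶜ :=
    ⟨{1}, fun g hg => ⟨0, by rw [Set.mem_singleton_iff.1 hg]; exact isHomogeneous_one _ _⟩,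
      by ext x; simp⟩
  have hne : (Set.univ : Set (Proj n)).Nonempty :=
    ⟨Projectivization.mk ℂ (fun _ => 1) fun h => one_ne_zero (congrFun h 0), trivial⟩
  exact hU.2 V hV.1 ((hV.2 _ huniv hne).mono Set.inter_subset_left)

lemma HasGradDegree.unique {f : MvPolynomial (Fin (n + 1)) ℂ} {k l : ℕ} (hk : HasGradDegree f k)
    (hl : HasGradDegree f l) : k = l := by
  obtain ⟨U, hU, hUk⟩ := hk
  obtain ⟨V, hV, hVl⟩ := hl
  obtain ⟨u, huU, huV⟩ := hU.inter_nonempty hV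
  rw [← (hUk u huU).2, (hVl u huV).2]

end ZariskiDense

section GradientFibre

/-- The affine solutions of `∇f(x)/f(x) = u`. -/
def logGradFiber {τ : Type*} (f : MvPolynomial τ ℂ) (u : τ → ℂ) : Set (τ → ℂ) :=
  {x | eval x f ≠ 0 ∧ ∀ j, eval x (pderiv j f) = eval x f * u j}

lemma sum_mul_eq_of_mem_logGradFiber {τ : Type*} [Fintype τ] {d : ℕ} {f : MvPolynomial τ ℂ}
    (hf : f.IsHomogeneous d) {u x : τ → ℂ} (hx : x ∈ logGradFiber f u) : ∑ j, x j * u j = d := by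
  have h := congrArg (eval x) hf.sum_X_mul_pderiv
  simp only [map_sum, map_mul, eval_X, hx.2, nsmul_eq_mul, map_natCast] at h
  refine mul_left_cancel₀ hx.1 ?_
  rw [mul_comm _ (d : ℂ), ← h, Finset.mul_sum]
  exact Finset.sum_congr rfl fun j _ => by ring

lemma mem_gradFiber_mk_iff {d : ℕ} {f : MvPolynomial (Fin (n + 1)) ℂ} (hf : f.IsHomogeneous d)
    {x u : Fin (n + 1) → ℂ} (hx : x ≠ 0) (hu : u ≠ 0) :
    Projectivization.mk ℂ x hx ∈ gradFiber f (Projectivization.mk ℂ u hu) ↔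
      eval x f ≠ 0 ∧ ∃ c : ℂ, c ≠ 0 ∧ ∀ j, eval x (pderiv j f) = c * u j := by
  obtain ⟨c, hc, hrep⟩ := exists_rep_mk_eq_smul hx
  refine and_congr (IsHomogeneous.eval_rep_mk_eq_zero_iff hf hx).not ?_
  have hgrad : gradVec f (Projectivization.mk ℂ x hx) =
      fun j => c ^ (d - 1) * eval x (pderiv j f) := by
    funext j
    rw [gradVec, hrep, IsHomogeneous.eval_smul_eq_pow_mul hf.pderiv]
  have hcd : c ^ (d - 1) ≠ 0 := pow_ne_zero _ hc
  constructor
  · rintro ⟨h, hmk⟩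
    obtain ⟨a, ha⟩ := (Projectivization.mk_eq_mk_iff ℂ _ _ h hu).1 hmk
    refine ⟨(c ^ (d - 1))⁻¹ * a, mul_ne_zero (inv_ne_zero hcd) a.ne_zero, fun j => ?_⟩
    have := congrFun (ha.trans hgrad) j
    rw [mul_assoc, eq_inv_mul_iff_mul_eq₀ hcd, ← this]
    rfl
  · rintro ⟨a, ha, h⟩
    have hg : gradVec f (Projectivization.mk ℂ x hx) = (c ^ (d - 1) * a) • u := by
      rw [hgrad]
      funext j
      rw [h, Pi.smul_apply, smul_eq_mul, mul_assoc]
    refine ⟨by rw [hg]; exact smul_ne_zero (mul_ne_zero hcd ha) hu, ?_⟩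
    rw [Projectivization.mk_eq_mk_iff']
    exact ⟨_, hg.symm⟩

lemma exists_bijOn_logGradFiber {d : ℕ} {f : MvPolynomial (Fin (n + 1)) ℂ} (hd : 0 < d)
    (hf : f.IsHomogeneous d) {u : Fin (n + 1) → ℂ} (hu : u ≠ 0) :
    ∃ F : (Fin (n + 1) → ℂ) → Proj n,
      Set.BijOn F (logGradFiber f u) (gradFiber f (Projectivization.mk ℂ u hu)) := by
  classical
  have hd' : (d : ℂ) ≠ 0 := Nat.cast_ne_zero.2 hd.ne'
  have hne (x) (hx : x ∈ logGradFiber f u) : x ≠ 0 := by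
    rintro rfl
    have := sum_mul_eq_of_mem_logGradFiber hf hx
    simp only [Pi.zero_apply, zero_mul, Finset.sum_const_zero] at this
    exact hd' this.symm
  let F (x : Fin (n + 1) → ℂ) : Proj n :=
    if hx : x = 0 then Projectivization.mk ℂ u hu else Projectivization.mk ℂ x hx
  have hF (x) (hx : x ≠ 0) : F x = Projectivization.mk ℂ x hx := dif_neg hx
  refine ⟨F, fun x hx => ?_, fun x hx y hy hxy => ?_, fun v hv => ?_⟩
  · rw [hF x (hne x hx), mem_gradFiber_mk_iff hf]
    exact ⟨hx.1, eval x f, hx.1, hx.2⟩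
  · rw [hF x (hne x hx), hF y (hne y hy), Projectivization.mk_eq_mk_iff'] at hxy
    obtain ⟨a, rfl⟩ := hxy
    have h1 := sum_mul_eq_of_mem_logGradFiber hf hx
    simp only [Pi.smul_apply, smul_eq_mul, mul_assoc, ← Finset.mul_sum,
      sum_mul_eq_of_mem_logGradFiber hf hy] at h1
    rw [(mul_eq_right₀ hd').1 h1, one_smul]
  · induction v using Projectivization.ind with
    | h x hx =>
      obtain ⟨hfx, c, hc, hcx⟩ := (mem_gradFiber_mk_iff hf hx hu).1 hv
      have hb : c / eval x f ≠ 0 := div_ne_zero hc hfx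
      refine ⟨(c / eval x f) • x, ⟨?_, fun j => ?_⟩, ?_⟩
      · rw [IsHomogeneous.eval_smul_eq_pow_mul hf]
        exact mul_ne_zero (pow_ne_zero _ hb) hfx
      · rw [IsHomogeneous.eval_smul_eq_pow_mul hf, IsHomogeneous.eval_smul_eq_pow_mul hf.pderiv,
          hcx]
        obtain ⟨e, rfl⟩ : ∃ e, d = e + 1 := ⟨d - 1, (Nat.sub_add_cancel hd).symm⟩
        rw [Nat.add_sub_cancel, pow_succ]
        field_simp
      · rw [hF _ (smul_ne_zero hb hx), Projectivization.mk_eq_mk_iff']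
        exact ⟨_, rfl⟩

lemma bijOn_extension_logGradFiber {τ A : Type*} [CommRing A] [Algebra ℂ A]
    [Algebra (MvPolynomial τ ℂ) A] [IsScalarTower ℂ (MvPolynomial τ ℂ) A] {f : MvPolynomial τ ℂ}
    [IsLocalization.Away f A] (u : τ → ℂ) :
    Set.BijOn (fun (h : A →+* ℂ) (j : τ) => h (algebraMap (MvPolynomial τ ℂ) A (X j)))
      {h | h.comp (logGradHom A f).toRingHom = eval u} (logGradFiber f u) := by
  have hfu : IsUnit (algebraMap _ A f) := IsLocalization.Away.algebraMap_isUnit f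
  have hlog (h : A →+* ℂ) (j : τ) : h (logGrad A f j) * h (algebraMap _ A f) =
      h (algebraMap _ A (pderiv j f)) := by
    rw [← map_mul, logGrad, mul_assoc, Ring.inverse_mul_cancel _ hfu, mul_one]
  have heval (h : A →+* ℂ) (hh : h.comp (logGradHom A f).toRingHom = eval u)
      (p : MvPolynomial τ ℂ) :
      h (algebraMap _ A p) = eval (fun j => h (algebraMap (MvPolynomial τ ℂ) A (X j))) p := by
    induction p using MvPolynomial.induction_on with
    | C a =>
      have h1 := RingHom.congr_fun hh (C a)
      rw [eval_C] at h1
      rw [eval_C]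
      refine (congrArg h ?_).trans h1
      rw [← algebraMap_eq, ← IsScalarTower.algebraMap_apply ℂ (MvPolynomial τ ℂ) A]
      exact ((logGradHom A f).commutes a).symm
    | add p q hp hq => simp only [map_add, hp, hq]
    | mul_X p j hp => simp only [map_mul, hp, eval_X]
  refine ⟨fun h hh => ?_, fun h hh h' hh' heq => ?_, fun x hx => ?_⟩
  · refine ⟨?_, fun j => ?_⟩
    · rw [← heval h hh]
      exact (hfu.map h).ne_zero
    · rw [← heval h hh, ← heval h hh, ← hlog, mul_comm]
      congr 1
      have h1 := RingHom.congr_fun hh (X j)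
      rw [eval_X] at h1
      rw [← h1, ← logGradHom_X]
      rfl
  · refine IsLocalization.ringHom_ext (Submonoid.powers f) (RingHom.ext fun p => ?_)
    rw [RingHom.comp_apply, RingHom.comp_apply, heval h hh, heval h' hh']
    exact congrArg (fun x => eval x p) heq
  · let h : A →+* ℂ := IsLocalization.Away.lift f (g := eval x) hx.1.isUnit
    have hh (p : MvPolynomial τ ℂ) : h (algebraMap _ A p) = eval x p :=
      IsLocalization.Away.lift_eq f _ p
    refine ⟨h, ?_, ?_⟩
    · refine MvPolynomial.ringHom_ext (fun a => ?_) fun j => ?_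
      · rw [eval_C, ← algebraMap_eq]
        refine (congrArg h ((logGradHom A f).commutes a)).trans ?_
        rw [IsScalarTower.algebraMap_apply ℂ (MvPolynomial τ ℂ) A, hh, algebraMap_eq, eval_C]
      · rw [eval_X]
        refine (congrArg h (logGradHom_X f j)).trans ?_
        have h1 := hlog h j
        rw [hh, hh, hx.2, mul_comm] at h1
        exact mul_left_cancel₀ hx.1 h1
    · funext j
      exact (hh (X j)).trans (eval_X _)

end GradientFibre

section GradientDegree

/-- Over a general point, the number of points of a fibre is the generic rank. -/
theorem AlgHom.exists_forall_ncard_extension_eq_genericRank.{u} {k R A K : Type u} [Field k]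
    [CommRing R] [IsDomain R] [IsIntegrallyClosed R] [CharZero R] [CommRing A] [IsDomain A]
    [Algebra k R] [Algebra k A] [Algebra.FiniteType k A] [Field K] [IsAlgClosed K] (φ : R →ₐ[k] A)
    (h : Algebra.trdeg k R = Algebra.trdeg k A) (hfin : Algebra.trdeg k A < Cardinal.aleph0) :
    ∃ P ≠ (0 : R), ∀ χ : R →+* K, χ P ≠ 0 →
      {h : A →+* K | h.comp φ.toRingHom = χ}.Finite ∧
      {h : A →+* K | h.comp φ.toRingHom = χ}.ncard = φ.toRingHom.genericRank := by
  by_cases hinj : Function.Injective φ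
  · let := φ.toRingHom.toAlgebra
    have : IsScalarTower k R A := .of_algebraMap_eq fun c => (φ.commutes c).symm
    have : FaithfulSMul R A := (faithfulSMul_iff_algebraMap_injective _ _).2 hinj
    have : Algebra.IsAlgebraic R A := isAlgebraic_of_trdeg_eq h hfin
    have : Algebra.FiniteType R A := .of_restrictScalars_finiteType k R A
    exact exists_forall_ncard_extension_eq_finrank
  · obtain ⟨P, hP, hP0⟩ : ∃ P, φ P = 0 ∧ P ≠ 0 := by
      by_contra! h'
      exact hinj ((injective_iff_map_eq_zero _).2 h')
    refine ⟨P, hP0, fun χ hχ => ?_⟩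
    have hempty : {h : A →+* K | h.comp φ.toRingHom = χ} = ∅ := by
      refine Set.eq_empty_iff_forall_notMem.2 fun h hh => hχ ?_
      rw [← RingHom.congr_fun hh P]
      exact (congrArg h hP).trans (map_zero h)
    rw [hempty, RingHom.genericRank_eq_zero hinj]
    exact ⟨Set.finite_empty, Set.ncard_empty _⟩

/-- The degree of the gradient map is the generic rank of the logarithmic gradient. -/
theorem hasGradDegree_genericRank {d : ℕ} {f : MvPolynomial (Fin (n + 1)) ℂ} (hf0 : f ≠ 0)
    (hd : 0 < d) (hf : f.IsHomogeneous d) (A : Type) [CommRing A] [IsDomain A] [Algebra ℂ A]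
    [Algebra (MvPolynomial (Fin (n + 1)) ℂ) A] [IsScalarTower ℂ (MvPolynomial (Fin (n + 1)) ℂ) A]
    [IsLocalization.Away f A] : HasGradDegree f (logGradHom A f).toRingHom.genericRank := by
  have htr : Algebra.trdeg ℂ A = Cardinal.mk (Fin (n + 1)) := trdeg_of_isLocalizationAway hf0
  have : Algebra.FiniteType (MvPolynomial (Fin (n + 1)) ℂ) A :=
    IsLocalization.finiteType_of_monoid_fg (Submonoid.powers f) A
  have : Algebra.FiniteType ℂ A := .trans (S := MvPolynomial (Fin (n + 1)) ℂ) inferInstance this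
  obtain ⟨P, hP0, hP⟩ := AlgHom.exists_forall_ncard_extension_eq_genericRank (K := ℂ)
    (logGradHom A f) (by rw [htr, MvPolynomial.trdeg_of_isDomain, Cardinal.lift_id])
    (by rw [htr]; exact Cardinal.mk_lt_aleph0)
  obtain ⟨m, hm⟩ : ∃ m, homogeneousComponent m P ≠ 0 := by
    by_contra! h
    exact hP0 (by rw [← sum_homogeneousComponent P]; exact Finset.sum_eq_zero fun i _ => h i)
  refine ⟨_, isZariskiOpenDense_principalOpen hm (homogeneousComponent_isHomogeneous m P),
    fun u hu => ?_⟩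
  obtain ⟨s, hs, hsP⟩ := exists_eval_smul_ne_zero hu
  have hsu : s • u.rep ≠ 0 := smul_ne_zero hs u.rep_nonzero
  have humk : Projectivization.mk ℂ (s • u.rep) hsu = u := by
    conv_rhs => rw [← u.mk_rep]
    exact (Projectivization.mk_eq_mk_iff' ℂ _ _ _ _).2 ⟨s, rfl⟩
  obtain ⟨F, hF⟩ := exists_bijOn_logGradFiber hd hf hsu
  rw [humk] at hF
  have hbij := hF.comp (bijOn_extension_logGradFiber (A := A) (f := f) (s • u.rep))
  obtain ⟨hfin, hcard⟩ := hP (eval (s • u.rep)) hsP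
  exact ⟨hbij.finite_iff_finite.1 hfin, by
    rw [← hcard, ← hbij.image_eq, hbij.injOn.ncard_image]⟩

end GradientDegree

section SameZeros

lemma exists_dvd_pow_of_forall_eval_eq_zero {τ : Type*} [Finite τ] {f g : MvPolynomial τ ℂ}
    (h : ∀ x, eval x f = 0 → eval x g = 0) : ∃ m : ℕ, f ∣ g ^ m := by
  have hg : g ∈ (Ideal.span {f}).radical := by
    rw [← vanishingIdeal_zeroLocus_eq_radical (K := ℂ), mem_vanishingIdeal_iff]
    intro x hx
    rw [aeval_eq_eval]
    refine h x ?_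
    rw [← aeval_eq_eval]
    exact hx f (Ideal.mem_span_singleton_self f)
  obtain ⟨m, hm⟩ := hg
  exact ⟨m, Ideal.mem_span_singleton.1 hm⟩

lemma isLocalizationAway_of_dvd_pow {R A : Type*} [CommRing R] [CommRing A] [Algebra R A] {f g : R}
    {l m : ℕ} (hfg : f ∣ g ^ m) (hgf : g ∣ f ^ l) [IsLocalization.Away f A] :
    IsLocalization.Away g A := by
  let N := Submonoid.powers f ⊔ Submonoid.powers g
  have hN {a b : R} {l : ℕ} (h : b ∣ a ^ l) (x : R)
      (hx : x ∈ Submonoid.powers a ⊔ Submonoid.powers b) :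
      ∃ y ∈ Submonoid.powers a, x ∣ y := by
    obtain ⟨_, ⟨i, rfl⟩, _, ⟨j, rfl⟩, rfl⟩ := Submonoid.mem_sup.1 hx
    refine ⟨a ^ (i + l * j), ⟨_, rfl⟩, ?_⟩
    rw [pow_add, pow_mul]
    exact mul_dvd_mul_left _ (pow_dvd_pow_of_dvd h j)
  have hf : IsLocalization N A :=
    (IsLocalization.iff_of_le_of_exists_dvd _ N le_sup_left (hN hgf)).1 inferInstance
  exact (IsLocalization.iff_of_le_of_exists_dvd (Submonoid.powers g) N le_sup_right fun x hx =>
    hN hfg x (by rwa [sup_comm])).2 hf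

lemma eval_eq_zero_of_projZeros_subset {df dg : ℕ} {f g : MvPolynomial (Fin (n + 1)) ℂ}
    (hdg : 0 < dg) (hf : f.IsHomogeneous df) (hg : g.IsHomogeneous dg)
    (h : projZeros f ⊆ projZeros g) (x : Fin (n + 1) → ℂ) (hx : eval x f = 0) : eval x g = 0 := by
  by_cases hx0 : x = 0
  · rw [hx0, ← zero_smul ℂ (0 : Fin (n + 1) → ℂ), IsHomogeneous.eval_smul_eq_pow_mul hg,
      zero_pow hdg.ne', zero_mul]
  · exact (IsHomogeneous.eval_rep_mk_eq_zero_iff hg hx0).1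
      (h ((IsHomogeneous.eval_rep_mk_eq_zero_iff hf hx0).2 hx))

end SameZeros

/-- Corollary 1.  The degree of the gradient map depends only
on the reduced polynomial associated to `f`: two non-constant homogeneous
polynomials with the same zero set in `ℙⁿ` have gradient maps of the same
degree. -/
theorem gradDegree_depends_only_on_reduced
    (n df dg : ℕ) (f g : MvPolynomial (Fin (n + 1)) ℂ)
    (hf0 : f ≠ 0) (hg0 : g ≠ 0) (hdf : 0 < df) (hdg : 0 < dg)
    (hf : f.IsHomogeneous df) (hg : g.IsHomogeneous dg)
    (hzeros : projZeros f = projZeros g) :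
    ∀ k : ℕ, HasGradDegree f k ↔ HasGradDegree g k := by
  obtain ⟨m, hfg⟩ := exists_dvd_pow_of_forall_eval_eq_zero
    (eval_eq_zero_of_projZeros_subset hdg hf hg hzeros.subset)
  obtain ⟨l, hgf⟩ := exists_dvd_pow_of_forall_eval_eq_zero
    (eval_eq_zero_of_projZeros_subset hdf hg hf hzeros.superset)
  let A := Localization.Away f
  have : IsDomain A :=
    IsLocalization.isDomain_localization (powers_le_nonZeroDivisors_of_noZeroDivisors hf0)
  have : IsLocalization.Away g A := isLocalizationAway_of_dvd_pow hfg hgf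
  have hfd := hasGradDegree_genericRank hf0 hdf hf A
  have hgd := hasGradDegree_genericRank hg0 hdg hg A
  rw [← genericRank_logGradHom_eq hf0 hg0 hf hg] at hgd
  exact fun k => ⟨fun hk => hk.unique hfd ▸ hgd, fun hk => hk.unique hgd ▸ hfd⟩

end
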